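/- Let u : ℝⁿ → ℝ be η-strongly convex for some η > 0. Then for every ε > 0 and every η̃ with 0 < η̃ < η, there exists an η̃-strongly convex function v ∈ C²(ℝⁿ) such that the Lebesgue measure of {x ∈ ℝⁿ : u(x) ≠ v(x)} is less than ε and sup_{x ∈ ℝⁿ} |u(x) − v(x)| < ε. -/

import Mathlib

open MeasureTheory Metric Set Filter
open scoped ENNReal

/-- `u : ℝⁿ → ℝ` is `η`-strongly convex: `x ↦ u x - (η/2)‖x‖²` is convex. -/
def StronglyConvexWith {n : ℕ} (η : ℝ) (u : EuclideanSpace ℝ (Fin n) → ℝ) : Prop :=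
  ConvexOn ℝ Set.univ (fun x => u x - η / 2 * ‖x‖ ^ 2)

open scoped Topology RealInnerProductSpace

section Conjugate

variable {E : Type*} [NormedAddCommGroup E] [InnerProductSpace ℝ E]
  {u : E → ℝ} {η : ℝ}

lemma StrongConvexOn.apply_combo_le {s : Set E} (hu : StrongConvexOn s η u) {x y : E} (hx : x ∈ s)
    (hy : y ∈ s) {a b : ℝ} (ha : 0 ≤ a) (hb : 0 ≤ b) (hab : a + b = 1) :
    u (a • x + b • y) ≤ a * u x + b * u y - a * b * (η / 2 * ‖x - y‖ ^ 2) := by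
  simpa using hu.2 hx hy ha hb hab

lemma StrongConvexOn.convexOn_univ (hη : 0 ≤ η) (hu : StrongConvexOn univ η u) :
    ConvexOn ℝ univ u :=
  strongConvexOn_zero.1 (hu.mono hη)

lemma StrongConvexOn.continuous [FiniteDimensional ℝ E] (hη : 0 ≤ η)
    (hu : StrongConvexOn univ η u) : Continuous u :=
  (hu.convexOn_univ hη).locallyLipschitz.continuous

/-- A strongly convex function grows quadratically away from a minimizer of a linear
perturbation. -/
lemma StrongConvexOn.add_sq_le_of_isMin (hu : StrongConvexOn univ η u)
    {y x : E} (hx : ∀ z, u x - ⟪y, x⟫ ≤ u z - ⟪y, z⟫) (z : E) :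
    u x - ⟪y, x⟫ + η / 2 * ‖z - x‖ ^ 2 ≤ u z - ⟪y, z⟫ := by
  have key : ∀ t ∈ Ioo (0 : ℝ) 1,
      (1 - t) * (η / 2 * ‖z - x‖ ^ 2) ≤ (u z - ⟪y, z⟫) - (u x - ⟪y, x⟫) := by
    intro t ht
    have h1 := hu.apply_combo_le (mem_univ x) (mem_univ z) (sub_nonneg.2 ht.2.le) ht.1.le
      (sub_add_cancel 1 t)
    have h2 := hx ((1 - t) • x + t • z)
    rw [inner_add_right, inner_smul_right, inner_smul_right] at h2
    rw [norm_sub_rev] at h1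
    have h3 : t * ((1 - t) * (η / 2 * ‖z - x‖ ^ 2))
        ≤ t * ((u z - ⟪y, z⟫) - (u x - ⟪y, x⟫)) := by nlinarith
    exact le_of_mul_le_mul_left h3 ht.1
  have h4 : Tendsto (fun t : ℝ => (1 - t) * (η / 2 * ‖z - x‖ ^ 2)) (𝓝[>] 0)
      (𝓝 ((1 - 0) * (η / 2 * ‖z - x‖ ^ 2))) := by
    refine Tendsto.mono_left ?_ nhdsWithin_le_nhds
    exact Continuous.tendsto (by fun_prop) 0
  have h5 := le_of_tendsto h4 (by
    filter_upwards [Ioo_mem_nhdsGT (zero_lt_one (α := ℝ))] with t ht using key t ht)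
  linarith

lemma StrongConvexOn.exists_isMin [FiniteDimensional ℝ E] (hη : 0 < η)
    (hu : StrongConvexOn univ η u) (y : E) :
    ∃ x, ∀ z, u x - ⟪y, x⟫ ≤ u z - ⟪y, z⟫ := by
  set f : E → ℝ := fun z => u z - ⟪y, z⟫ with hf
  have hfc : Continuous f := by
    have := hu.continuous hη.le
    fun_prop
  have hfs : ∀ (z : E) (t : ℝ), 0 ≤ t → t ≤ 1 →
      f (t • z) ≤ (1 - t) * f 0 + t * f z - t * (1 - t) * (η / 2 * ‖z‖ ^ 2) := by
    intro z t ht0 ht1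
    have h1 := hu.apply_combo_le (mem_univ 0) (mem_univ z) (sub_nonneg.2 ht1) ht0
      (sub_add_cancel 1 t)
    simp only [smul_zero, zero_add, zero_sub, norm_neg] at h1
    simp only [hf, inner_smul_right, inner_zero_right]
    nlinarith
  obtain ⟨B, hB⟩ := (isCompact_closedBall (0 : E) 1).exists_bound_of_continuousOn hfc.continuousOn
  set R : ℝ := 2 + 2 / η * (B + f 0) with hR
  have hB0 : |f 0| ≤ B := by simpa using hB 0 (by simp)
  have hRB : 2 ≤ R := by
    have : 0 ≤ 2 / η * (B + f 0) := by
      have := neg_abs_le (f 0)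
      have : 0 ≤ B + f 0 := by linarith
      positivity
    linarith
  obtain ⟨x, -, hx⟩ := (isCompact_closedBall (0 : E) R).exists_isMinOn
    ⟨0, by simp; linarith⟩ hfc.continuousOn
  refine ⟨x, fun z => ?_⟩
  by_cases hz : ‖z‖ ≤ R
  · exact hx (by simpa using hz)
  · push Not at hz
    have h0 : f x ≤ f 0 := hx (by simp; linarith)
    refine h0.trans ?_
    have hz0 : 0 < ‖z‖ := by linarith
    have h1 := hfs z (1 / ‖z‖) (by positivity) (by rw [div_le_one hz0]; linarith)
    have h2 : |f ((1 / ‖z‖) • z)| ≤ B := hB _ (by simp [norm_smul, hz0.ne'])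
    have h3 := neg_abs_le (f ((1 / ‖z‖) • z))
    have h4 : ‖z‖ * (-B) ≤ ‖z‖ * ((1 - 1 / ‖z‖) * f 0 + 1 / ‖z‖ * f z
        - 1 / ‖z‖ * (1 - 1 / ‖z‖) * (η / 2 * ‖z‖ ^ 2)) := by
      apply mul_le_mul_of_nonneg_left _ hz0.le; linarith
    have h5 : ‖z‖ * ((1 - 1 / ‖z‖) * f 0 + 1 / ‖z‖ * f z
        - 1 / ‖z‖ * (1 - 1 / ‖z‖) * (η / 2 * ‖z‖ ^ 2)) =
        (‖z‖ - 1) * f 0 + f z - (‖z‖ - 1) * (η / 2 * ‖z‖) := by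
      field_simp
    rw [h5] at h4
    have h6 : η / 2 * R = η + (B + f 0) := by rw [hR]; field_simp
    have h7 : B + f 0 + η < η / 2 * ‖z‖ := by
      have : η / 2 * R < η / 2 * ‖z‖ := by gcongr
      linarith
    have : f 0 ≤ f z := by nlinarith
    exact this

/-- `G` assigns to each slope `y` the minimizer of `u - ⟪y, ·⟫`; it is the gradient of the
convex conjugate of `u`. -/
def IsConjGradient (u : E → ℝ) (η : ℝ) (G : E → E) : Prop :=
  ∀ y z, u (G y) - ⟪y, G y⟫ + η / 2 * ‖z - G y‖ ^ 2 ≤ u z - ⟪y, z⟫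

lemma StrongConvexOn.exists_isConjGradient [FiniteDimensional ℝ E] (hη : 0 < η)
    (hu : StrongConvexOn univ η u) : ∃ G, IsConjGradient u η G := by
  choose G hG using hu.exists_isMin hη
  exact ⟨G, fun y z => hu.add_sq_le_of_isMin (hG y) z⟩

namespace IsConjGradient

variable {G : E → E}

lemma sq_le_inner (hG : IsConjGradient u η G) (y y' : E) :
    η * ‖G y - G y'‖ ^ 2 ≤ ⟪y - y', G y - G y'⟫ := by
  have h1 := hG y (G y')
  have h2 := hG y' (G y)
  rw [norm_sub_rev] at h1
  simp only [inner_sub_left, inner_sub_right]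
  linarith

lemma norm_sub_le (hη : 0 < η) (hG : IsConjGradient u η G) (y y' : E) :
    ‖G y - G y'‖ ≤ η⁻¹ * ‖y - y'‖ := by
  have h1 := hG.sq_le_inner y y'
  have h2 := real_inner_le_norm (y - y') (G y - G y')
  rcases (norm_nonneg (G y - G y')).eq_or_lt with h | h
  · rw [← h]; positivity
  · have : η * ‖G y - G y'‖ ≤ ‖y - y'‖ := by
      refine le_of_mul_le_mul_right ?_ h
      nlinarith
    rw [inv_mul_eq_div, le_div_iff₀ hη]; linarith

lemma lipschitzWith (hη : 0 < η) (hG : IsConjGradient u η G) :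
    LipschitzWith (Real.toNNReal η⁻¹) G :=
  LipschitzWith.of_dist_le_mul fun y y' => by
    rw [dist_eq_norm, dist_eq_norm, Real.coe_toNNReal _ (by positivity)]
    exact hG.norm_sub_le hη _ _

/-- The convex conjugate of `u`, written in terms of its gradient `G`, has derivative `G`. -/
lemma hasFDerivAt_conj (hη : 0 < η) (hG : IsConjGradient u η G) (y : E) :
    HasFDerivAt (fun q => ⟪q, G q⟫ - u (G q)) (innerSL ℝ (G y)) y := by
  rw [hasFDerivAt_iff_isLittleO_nhds_zero]
  have hO : (fun h : E => ⟪y + h, G (y + h)⟫ - u (G (y + h)) - (⟪y, G y⟫ - u (G y))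
      - innerSL ℝ (G y) h) =O[𝓝 0] fun h => ‖h‖ ^ 2 := by
    refine Asymptotics.IsBigO.of_bound η⁻¹ (Eventually.of_forall fun h => ?_)
    rw [innerSL_apply_apply, real_inner_comm h (G y), Real.norm_eq_abs, norm_pow, norm_norm]
    have h1 := hG y (G (y + h))
    have h2 := hG (y + h) (G y)
    have h0 : 0 ≤ η / 2 * ‖G (y + h) - G y‖ ^ 2 := by positivity
    have h0' : 0 ≤ η / 2 * ‖G y - G (y + h)‖ ^ 2 := by positivity
    have h3 := real_inner_le_norm h (G (y + h) - G y)
    have h4 : ‖h‖ * ‖G (y + h) - G y‖ ≤ ‖h‖ * (η⁻¹ * ‖h‖) := by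
      gcongr
      simpa using hG.norm_sub_le hη (y + h) y
    rw [inner_sub_right] at h3
    simp only [inner_add_left] at h1 h2 h3 ⊢
    rw [abs_le]
    constructor <;> nlinarith
  refine hO.trans_isLittleO ?_
  have : (fun h : E => ‖h‖ ^ 2) =o[𝓝 0] fun h : E => ‖h‖ ^ 1 :=
    (Asymptotics.isLittleO_pow_pow one_lt_two).comp_tendsto tendsto_norm_zero
  exact Asymptotics.isLittleO_norm_right.1 (by simpa using this)

lemma eq_of_hasFDerivAt (hη : 0 < η) (hu : ConvexOn ℝ univ u) (hG : IsConjGradient u η G)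
    {x p : E} (hp : HasFDerivAt u (innerSL ℝ p) x) : G p = x := by
  have hsub : ∀ z, u x + ⟪p, z - x⟫ ≤ u z := by
    intro z
    have hl : HasDerivAt (fun t : ℝ => u (AffineMap.lineMap x z t)) ⟪p, z - x⟫ 0 := by
      have h1 : HasDerivAt (fun t : ℝ => AffineMap.lineMap x z t) (z - x) (0 : ℝ) := by
        simpa using AffineMap.hasDerivAt_lineMap (a := x) (b := z) (x := (0 : ℝ))
      have h2 : HasFDerivAt u (innerSL ℝ p) (AffineMap.lineMap x z (0 : ℝ)) := by simpa using hp
      exact h2.comp_hasDerivAt (0 : ℝ) h1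
    have hc : ConvexOn ℝ univ (fun t : ℝ => u (AffineMap.lineMap x z t)) :=
      hu.comp_affineMap (AffineMap.lineMap x z)
    have := hc.le_slope_of_hasDerivAt (mem_univ 0) (mem_univ 1) zero_lt_one hl
    simp [slope_def_field] at this
    linarith
  have h1 := hG p x
  have h2 := hsub (G p)
  rw [inner_sub_right] at h2
  have h3 : η / 2 * ‖x - G p‖ ^ 2 ≤ 0 := by linarith
  have h4 : ‖x - G p‖ ^ 2 ≤ 0 := by
    by_contra h; push Not at h
    have : 0 < η / 2 * ‖x - G p‖ ^ 2 := by positivity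
    linarith
  have h5 : ‖x - G p‖ = 0 := by
    have := norm_nonneg (x - G p)
    nlinarith
  exact (sub_eq_zero.1 (norm_eq_zero.1 h5)).symm

end IsConjGradient

end Conjugate

section SecondOrder

variable {E : Type*} [NormedAddCommGroup E] [InnerProductSpace ℝ E]
  {u : E → ℝ} {η : ℝ} {G : E → E} {p : E} {A B : E →L[ℝ] E}

namespace IsConjGradient

lemma conj_taylor (hη : 0 < η) (hG : IsConjGradient u η G) (hA : HasFDerivAt G A p)
    {ε : ℝ} (hε : 0 < ε) :
    ∃ r > 0, ∀ k : E, ‖k‖ ≤ r →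
      |(⟪p + k, G (p + k)⟫ - u (G (p + k))) - (⟪p, G p⟫ - u (G p)) - ⟪G p, k⟫ - 1 / 2 * ⟪A k, k⟫|
        ≤ ε * ‖k‖ ^ 2 := by
  rw [hasFDerivAt_iff_isLittleO_nhds_zero] at hA
  obtain ⟨r, hr, hr'⟩ := Metric.eventually_nhds_iff_ball.1 (hA.def hε)
  refine ⟨r / 2, by positivity, fun k hk => ?_⟩
  set φ : ℝ → ℝ := fun t => (⟪p + t • k, G (p + t • k)⟫ - u (G (p + t • k))) - t * ⟪G p, k⟫
    - t ^ 2 * (1 / 2 * ⟪A k, k⟫) with hφ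
  have hder : ∀ t : ℝ, HasDerivAt φ (⟪G (p + t • k) - G p - A (t • k), k⟫) t := by
    intro t
    have h1 : HasDerivAt (fun t : ℝ => p + t • k) k t := by
      simpa using ((hasDerivAt_id t).smul_const k).const_add p
    have h2 : HasDerivAt (fun t : ℝ => ⟪p + t • k, G (p + t • k)⟫ - u (G (p + t • k)))
        (⟪G (p + t • k), k⟫) t := by
      have := (hG.hasFDerivAt_conj hη (p + t • k)).comp_hasDerivAt t h1
      exact this
    have h3 : HasDerivAt (fun t : ℝ => t * ⟪G p, k⟫) ⟪G p, k⟫ t := by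
      simpa using (hasDerivAt_id t).mul_const ⟪G p, k⟫
    have h4 : HasDerivAt (fun t : ℝ => t ^ 2 * (1 / 2 * ⟪A k, k⟫)) (t * ⟪A k, k⟫) t := by
      exact ((hasDerivAt_pow 2 t).mul_const (1 / 2 * ⟪A k, k⟫)).congr_deriv (by simp; ring)
    refine ((h2.sub h3).sub h4).congr_deriv ?_
    rw [inner_sub_left, inner_sub_left, map_smul, real_inner_smul_left]
  have hb : ∀ t ∈ Ico (0 : ℝ) 1, ‖⟪G (p + t • k) - G p - A (t • k), k⟫‖ ≤ ε * ‖k‖ ^ 2 := by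
    intro t ht
    have htk : ‖t • k‖ ≤ ‖k‖ := by
      rw [norm_smul, Real.norm_of_nonneg ht.1]
      exact mul_le_of_le_one_left (norm_nonneg _) ht.2.le
    have h1 := hr' (t • k) (by simp only [mem_ball, dist_zero_right]; linarith)
    calc ‖⟪G (p + t • k) - G p - A (t • k), k⟫‖
        ≤ ‖G (p + t • k) - G p - A (t • k)‖ * ‖k‖ := norm_inner_le_norm _ _
      _ ≤ (ε * ‖k‖) * ‖k‖ := by gcongr; exact h1.trans (by gcongr)
      _ = ε * ‖k‖ ^ 2 := by ring
  have := norm_image_sub_le_of_norm_deriv_le_segment_01' (f := φ)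
    (fun t _ => (hder t).hasDerivWithinAt) hb
  rw [Real.norm_eq_abs] at this
  refine le_trans (le_of_eq ?_) this
  congr 1
  simp [hφ]
  ring

lemma inner_deriv_symm (hη : 0 < η) (hG : IsConjGradient u η G) (hA : HasFDerivAt G A p)
    (h k : E) : ⟪A h, k⟫ = ⟪A k, h⟫ := by
  have h1 : HasFDerivAt (fun q => innerSL ℝ (G q)) ((innerSL ℝ).comp A) p :=
    (innerSL ℝ (E := E)).hasFDerivAt.comp p hA
  have := second_derivative_symmetric_of_eventually_of_real
    (Eventually.of_forall (hG.hasFDerivAt_conj hη)) h1 h k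
  simpa using this

lemma sq_deriv_le_inner (hG : IsConjGradient u η G) (hA : HasFDerivAt G A p)
    (k : E) : η * ‖A k‖ ^ 2 ≤ ⟪A k, k⟫ := by
  have h1 : HasDerivAt (fun t : ℝ => p + t • k) k 0 := by
    simpa using ((hasDerivAt_id (0 : ℝ)).smul_const k).const_add p
  have h2 : HasDerivAt (fun t : ℝ => G (p + t • k)) (A k) 0 := by
    have hA' : HasFDerivAt G A (p + (0 : ℝ) • k) := by simpa using hA
    exact hA'.comp_hasDerivAt (0 : ℝ) h1
  have h3 := h2.tendsto_slope_zero_right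
  simp only [zero_add, zero_smul, add_zero] at h3
  have h4 := ((h3.norm.pow 2).const_mul η)
  have h5 := Filter.Tendsto.inner (𝕜 := ℝ) h3 (tendsto_const_nhds (x := k))
  refine le_of_tendsto_of_tendsto h4 h5 ?_
  filter_upwards [self_mem_nhdsWithin] with t ht
  have ht : 0 < t := ht
  have := hG.sq_le_inner (p + t • k) p
  rw [add_sub_cancel_left, real_inner_smul_left, real_inner_comm] at this
  rw [norm_smul, real_inner_smul_left, mul_pow, Real.norm_eq_abs, sq_abs]
  calc η * (t⁻¹ ^ 2 * ‖G (p + t • k) - G p‖ ^ 2)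
      = t⁻¹ ^ 2 * (η * ‖G (p + t • k) - G p‖ ^ 2) := by ring
    _ ≤ t⁻¹ ^ 2 * (t * ⟪G (p + t • k) - G p, k⟫) := by gcongr
    _ = t⁻¹ * ⟪G (p + t • k) - G p, k⟫ := by field_simp

/-- If the conjugate gradient is differentiable at `p` with invertible derivative `A`, then `u` has
a second order Taylor expansion at `G p`, with Hessian `A⁻¹`. -/
lemma taylor (hη : 0 < η) (hu : Continuous u) (hG : IsConjGradient u η G)
    (hd : Dense (range G)) (hA : HasFDerivAt G A p) (hAB : ∀ h, A (B h) = h)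
    (hBA : ∀ h, B (A h) = h) {ε : ℝ} (hε : 0 < ε) :
    ∃ r > 0, ∀ h : E, ‖h‖ ≤ r →
      |u (G p + h) - u (G p) - ⟪p, h⟫ - 1 / 2 * ⟪B h, h⟫| ≤ ε * ‖h‖ ^ 2 := by
  set x := G p with hx
  set f : E → ℝ := fun h => u (x + h) - u x - ⟪p, h⟫ with hf
  set g : E → ℝ := fun k => (⟪p + k, G (p + k)⟫ - u (G (p + k))) - (⟪p, x⟫ - u x) - ⟪x, k⟫ with hg
  have hyoung : ∀ h k, ⟪h, k⟫ ≤ f h + g k := by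
    intro h k
    have h1 := hG (p + k) (x + h)
    have h2 : 0 ≤ η / 2 * ‖x + h - G (p + k)‖ ^ 2 := by positivity
    simp only [inner_add_right, inner_add_left] at h1 ⊢
    simp only [hf, hg, inner_add_left]
    have h3 := real_inner_comm k x
    have h4 := real_inner_comm k h
    linarith
  have hyoung_eq : ∀ h k, G (p + k) = x + h → ⟪h, k⟫ = f h + g k := by
    intro h k hk
    simp only [hf, hg, inner_add_right, inner_add_left, hk]
    rw [real_inner_comm k h, real_inner_comm k x]
    ring
  have hf0 : ∀ h, 0 ≤ f h := by
    intro h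
    have h1 := hyoung h 0
    have : g 0 = 0 := by simp [hg, ← hx]
    simpa [this] using h1
  have hg0 : ∀ k (s : ℝ), 1 ≤ s → s * g k ≤ g (s • k) := by
    intro k s hs
    have h1 := hyoung_eq (G (p + k) - x) k (by abel)
    have h2 := hyoung (G (p + k) - x) (s • k)
    rw [inner_smul_right] at h2
    have h3 := hf0 (G (p + k) - x)
    nlinarith
  -- coercivity of `A`
  obtain ⟨c, hc, hAc⟩ : ∃ c > 0, ∀ k, c * ‖k‖ ^ 2 ≤ ⟪A k, k⟫ := by
    refine ⟨η / (‖B‖ + 1) ^ 2, by positivity, fun k => ?_⟩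
    refine le_trans ?_ (hG.sq_deriv_le_inner hA k)
    have h1 : ‖k‖ ≤ (‖B‖ + 1) * ‖A k‖ := by
      calc ‖k‖ = ‖B (A k)‖ := by rw [hBA]
        _ ≤ ‖B‖ * ‖A k‖ := B.le_opNorm _
        _ ≤ _ := by gcongr; linarith
    calc η / (‖B‖ + 1) ^ 2 * ‖k‖ ^ 2 ≤ η / (‖B‖ + 1) ^ 2 * ((‖B‖ + 1) * ‖A k‖) ^ 2 := by gcongr
      _ = η * ‖A k‖ ^ 2 := by field_simp
  have hsym := hG.inner_deriv_symm hη hA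
  -- Taylor expansion of the conjugate at two precisions
  set ε' := min (c / 4) (ε / (‖B‖ ^ 2 + 16 / c ^ 2 + 1)) with hε'
  have hε'0 : 0 < ε' := by positivity
  obtain ⟨r, hr, hT⟩ := hG.conj_taylor hη hA hε'0
  have hT' : ∀ k, ‖k‖ ≤ r → c / 4 * ‖k‖ ^ 2 ≤ g k := by
    intro k hk
    have h1 := (abs_le.1 (hT k hk)).1
    have h2 : ε' * ‖k‖ ^ 2 ≤ c / 4 * ‖k‖ ^ 2 := by gcongr; exact min_le_left _ _
    have h3 := hAc k
    simp only [hg]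
    linarith
  have hε1 : ε' * ‖B‖ ^ 2 ≤ ε ∧ ε' * (16 / c ^ 2) ≤ ε := by
    have h1 : ε' * (‖B‖ ^ 2 + 16 / c ^ 2 + 1) ≤ ε := by
      calc ε' * (‖B‖ ^ 2 + 16 / c ^ 2 + 1)
          ≤ ε / (‖B‖ ^ 2 + 16 / c ^ 2 + 1) * (‖B‖ ^ 2 + 16 / c ^ 2 + 1) := by
            gcongr; exact min_le_right _ _
        _ = ε := by field_simp
    have h2 : 0 ≤ ε' * ‖B‖ ^ 2 := by positivity
    have h3 : 0 ≤ ε' * (16 / c ^ 2) := by positivity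
    constructor <;> nlinarith
  have hlow : ∀ h, ‖B h‖ ≤ r → -(ε * ‖h‖ ^ 2) ≤ f h - 1 / 2 * ⟪B h, h⟫ := by
    intro h hh
    have h1 := hyoung h (B h)
    have h2 := (abs_le.1 (hT (B h) hh)).2
    rw [hAB, real_inner_comm (B h) h] at h2
    rw [real_inner_comm (B h) h] at h1
    have h3 : ε' * ‖B h‖ ^ 2 ≤ ε * ‖h‖ ^ 2 := by
      calc ε' * ‖B h‖ ^ 2 ≤ ε' * (‖B‖ * ‖h‖) ^ 2 := by gcongr; exact B.le_opNorm h
        _ = ε' * ‖B‖ ^ 2 * ‖h‖ ^ 2 := by ring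
        _ ≤ _ := by gcongr; exact hε1.1
    simp only [hg] at h1
    linarith
  have hup : ∀ h, ‖h‖ < c * r / 4 → x + h ∈ range G → f h - 1 / 2 * ⟪B h, h⟫ ≤ ε * ‖h‖ ^ 2 := by
    rintro h hh ⟨q, hq⟩
    obtain ⟨k, rfl⟩ : ∃ k, q = p + k := ⟨q - p, by abel⟩
    have h1 := hyoung_eq h k hq
    have h2 := real_inner_le_norm h k
    have hgk : g k ≤ ‖h‖ * ‖k‖ := by linarith [hf0 h]
    have hkr : ‖k‖ ≤ r := by
      by_contra hkr; push Not at hkr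
      have hk0 : 0 < ‖k‖ := hr.trans hkr
      have h3 := hg0 ((r / ‖k‖) • k) (‖k‖ / r) (by rw [le_div_iff₀ hr]; linarith)
      have hn : ‖(r / ‖k‖) • k‖ = r := by
        rw [norm_smul, Real.norm_of_nonneg (by positivity)]; field_simp
      have h4 := hT' ((r / ‖k‖) • k) hn.le
      rw [hn] at h4
      rw [smul_smul, show ‖k‖ / r * (r / ‖k‖) = 1 by field_simp, one_smul] at h3
      have h5 : ‖k‖ / r * (c / 4 * r ^ 2) ≤ ‖h‖ * ‖k‖ := by
        refine le_trans ?_ (h3.trans hgk); gcongr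
      have h6 : ‖k‖ / r * (c / 4 * r ^ 2) = c * r / 4 * ‖k‖ := by field_simp
      rw [h6] at h5
      exact absurd (le_of_mul_le_mul_right h5 hk0) (not_le.2 hh)
    have hkh : ‖k‖ ≤ 4 / c * ‖h‖ := by
      have h3 := (hT' k hkr).trans hgk
      rcases (norm_nonneg k).eq_or_lt with h0 | h0
      · rw [← h0]; positivity
      · have h4 : c / 4 * ‖k‖ ≤ ‖h‖ := le_of_mul_le_mul_right (by nlinarith) h0
        calc ‖k‖ = 4 / c * (c / 4 * ‖k‖) := by field_simp
          _ ≤ _ := by gcongr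
    have h3 := (abs_le.1 (hT k hkr)).1
    have h4 : 0 ≤ ⟪A (k - B h), k - B h⟫ := le_trans (by positivity) (hAc _)
    rw [map_sub, hAB, inner_sub_left, inner_sub_right, inner_sub_right, hsym k (B h), hAB,
      real_inner_comm (B h) h] at h4
    have h5 : ε' * ‖k‖ ^ 2 ≤ ε * ‖h‖ ^ 2 := by
      calc ε' * ‖k‖ ^ 2 ≤ ε' * (4 / c * ‖h‖) ^ 2 := by gcongr
        _ = ε' * (16 / c ^ 2) * ‖h‖ ^ 2 := by ring
        _ ≤ _ := by gcongr; exact hε1.2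
    simp only [hg] at h1
    linarith
  refine ⟨min (r / (‖B‖ + 1)) (c * r / 8), by positivity, fun h hh => ?_⟩
  have hcr : ‖h‖ < c * r / 4 :=
    lt_of_le_of_lt (hh.trans (min_le_right _ _)) (by have : 0 < c * r := by positivity
                                                     linarith)
  rw [abs_le]
  refine ⟨hlow h ?_, ?_⟩
  · calc ‖B h‖ ≤ ‖B‖ * ‖h‖ := B.le_opNorm h
      _ ≤ (‖B‖ + 1) * (r / (‖B‖ + 1)) := by
        gcongr
        · linarith
        · exact hh.trans (min_le_left _ _)
      _ = r := by field_simp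
  · have hd' : Dense ((fun z => z - x) '' range G) :=
      (Homeomorph.subRight x).surjective.denseRange.dense_image (by fun_prop) hd
    have hcl : IsClosed {h : E | f h - 1 / 2 * ⟪B h, h⟫ ≤ ε * ‖h‖ ^ 2} :=
      isClosed_le (by fun_prop) (by fun_prop)
    have hmem : h ∈ closure (ball (0 : E) (c * r / 4) ∩ (fun z => z - x) '' range G) :=
      hd'.open_subset_closure_inter isOpen_ball (by simpa using hcr)
    refine hcl.closure_subset_iff.2 ?_ hmem
    rintro h' ⟨hb, z, hz, rfl⟩
    exact hup _ (by simpa using hb) (by simpa using hz)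

end IsConjGradient

end SecondOrder

section Alexandrov

variable {E : Type*} [NormedAddCommGroup E] [InnerProductSpace ℝ E] [FiniteDimensional ℝ E]
  [MeasurableSpace E] [BorelSpace E]

lemma LocallyLipschitz.ae_differentiableAt {u : E → ℝ} (hu : LocallyLipschitz u) (μ : Measure E)
    [μ.IsAddHaarMeasure] : ∀ᵐ x ∂μ, DifferentiableAt ℝ u x := by
  choose C t ht hC using hu
  obtain ⟨s, hs, hst⟩ := TopologicalSpace.countable_cover_nhds (fun x => interior_mem_nhds.2 (ht x))
  have : ∀ᵐ x ∂μ, ∀ i ∈ s, x ∈ interior (t i) →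
      DifferentiableWithinAt ℝ u (interior (t i)) x := by
    rw [ae_ball_iff hs]
    exact fun i _ => ((hC i).mono interior_subset).ae_differentiableWithinAt_of_mem
  filter_upwards [this] with x hx
  have hx' : x ∈ ⋃ i ∈ s, interior (t i) := hst ▸ mem_univ x
  simp only [mem_iUnion] at hx'
  obtain ⟨i, hi, hxi⟩ := hx'
  exact (hx i hi hxi).differentiableAt (isOpen_interior.mem_nhds hxi)

lemma LipschitzWith.measure_image_eq_zero {C : NNReal} {f : E → E} (hf : LipschitzWith C f)
    (μ : Measure E) [μ.IsAddHaarMeasure] {s : Set E} (hs : μ s = 0) : μ (f '' s) = 0 := by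
  set ν : Measure E := Measure.hausdorffMeasure (Module.finrank ℝ E)
  have h1 : ν s = 0 := Measure.absolutelyContinuous_isAddHaarMeasure ν μ hs
  have h2 : ν (f '' s) = 0 := by
    have := hf.hausdorffMeasure_image_le (d := Module.finrank ℝ E) (by positivity) s
    have h3 : ν (f '' s) ≤ (C : ℝ≥0∞) ^ (Module.finrank ℝ E : ℝ) * ν s := this
    rw [h1, mul_zero] at h3
    exact nonpos_iff_eq_zero.1 h3
  exact Measure.absolutelyContinuous_isAddHaarMeasure μ ν h2

lemma IsConjGradient.ae_mem_image {u : E → ℝ} {η : ℝ} {G : E → E} (hη : 0 < η)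
    (hu : StrongConvexOn univ η u) (hG : IsConjGradient u η G) (μ : Measure E)
    [μ.IsAddHaarMeasure] :
    ∀ᵐ x ∂μ, ∃ p, HasFDerivAt u (innerSL ℝ p) x ∧ G p = x ∧ DifferentiableAt ℝ G p ∧
      (fderiv ℝ G p).det ≠ 0 := by
  have hc := hu.convexOn_univ hη.le
  have h1 := hc.locallyLipschitz.ae_differentiableAt μ
  have h2 : ∀ᵐ x ∂μ, x ∉ G '' {p | ¬ DifferentiableAt ℝ G p} := by
    refine measure_eq_zero_iff_ae_notMem.1 ?_
    refine (hG.lipschitzWith hη).measure_image_eq_zero μ ?_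
    exact (hG.lipschitzWith hη).ae_differentiableAt
  have h3 : ∀ᵐ x ∂μ, x ∉ G '' {p | DifferentiableAt ℝ G p ∧ (fderiv ℝ G p).det = 0} := by
    refine measure_eq_zero_iff_ae_notMem.1 ?_
    exact addHaar_image_eq_zero_of_det_fderivWithin_eq_zero μ
      (fun x hx => hx.1.hasFDerivAt.hasFDerivWithinAt) (fun x hx => hx.2)
  filter_upwards [h1, h2, h3] with x hx1 hx2 hx3
  obtain ⟨p, hp⟩ : ∃ p, innerSL ℝ p = fderiv ℝ u x :=
    ⟨(InnerProductSpace.toDual ℝ E).symm (fderiv ℝ u x), by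
      ext v; simp⟩
  have hpx : HasFDerivAt u (innerSL ℝ p) x := hp ▸ hx1.hasFDerivAt
  have hGp := hG.eq_of_hasFDerivAt hη hc hpx
  have hd : DifferentiableAt ℝ G p := by
    by_contra hd
    exact hx2 ⟨p, hd, hGp⟩
  exact ⟨p, hpx, hGp, hd, fun h0 => hx3 ⟨p, ⟨hd, h0⟩, hGp⟩⟩

lemma measurable_ringInverse {R : Type*} [NormedRing R] [CompleteSpace R] [MeasurableSpace R]
    [BorelSpace R] : Measurable (Ring.inverse : R → R) := by
  classical
  have h : (Ring.inverse : R → R) = {x : R | IsUnit x}.piecewise Ring.inverse 0 := by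
    ext x
    by_cases hx : IsUnit x
    · simp [Set.piecewise, hx]
    · simp [Set.piecewise, hx]
  rw [h]
  refine ContinuousOn.measurable_piecewise ?_ continuousOn_const Units.isOpen.measurableSet
  rintro x ⟨y, rfl⟩
  exact (NormedRing.inverse_continuousAt y).continuousWithinAt

/-- Alexandrov's theorem for strongly convex functions, with measurable derivatives. -/
lemma StrongConvexOn.ae_taylor {u : E → ℝ} {η : ℝ} (hη : 0 < η)
    (hu : StrongConvexOn univ η u) (μ : Measure E) [μ.IsAddHaarMeasure] :
    ∃ (q : E → E →L[ℝ] ℝ) (H : E → E →L[ℝ] E), Measurable q ∧ Measurable H ∧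
      ∀ᵐ x ∂μ, ∀ ε > 0, ∃ r > 0, ∀ h : E, ‖h‖ ≤ r →
        |u (x + h) - u x - q x h - 1 / 2 * ⟪H x h, h⟫| ≤ ε * ‖h‖ ^ 2 := by
  obtain ⟨G, hG⟩ := hu.exists_isConjGradient hη
  have hae := hG.ae_mem_image hη hu μ
  have hdense : Dense (range G) := by
    refine (μ.dense_of_ae hae).mono ?_
    rintro x ⟨p, -, rfl, -⟩
    exact mem_range_self p
  refine ⟨fderiv ℝ u, fun x => Ring.inverse (fderiv ℝ G ((InnerProductSpace.toDual ℝ E).symm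
    (fderiv ℝ u x))), measurable_fderiv ℝ u, ?_, ?_⟩
  · refine measurable_ringInverse.comp ((measurable_fderiv ℝ G).comp ?_)
    exact (InnerProductSpace.toDual ℝ E).symm.continuous.measurable.comp (measurable_fderiv ℝ u)
  · filter_upwards [hae] with x hx ε hε
    obtain ⟨p, hp, rfl, hd, hdet⟩ := hx
    have hps : (InnerProductSpace.toDual ℝ E).symm (fderiv ℝ u (G p)) = p := by
      rw [hp.fderiv, LinearIsometryEquiv.symm_apply_eq]
      ext v; simp
    rw [hps]
    have hU : IsUnit (fderiv ℝ G p) := by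
      let e := ContinuousLinearMap.toContinuousLinearEquivOfDetNeZero (fderiv ℝ G p) hdet
      refine ⟨ContinuousLinearEquiv.toUnit e, ?_⟩
      ext v; rfl
    have hAB := Ring.mul_inverse_cancel _ hU
    have hBA := Ring.inverse_mul_cancel _ hU
    obtain ⟨r, hr, h⟩ := hG.taylor hη (hu.continuous hη.le) hdense hd.hasFDerivAt
      (fun h => by rw [← mul_apply_eq_comp, hAB]; rfl)
      (fun h => by rw [← mul_apply_eq_comp, hBA]; rfl) hε
    refine ⟨r, hr, fun k hk => ?_⟩
    rw [hp.fderiv]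
    exact h k hk

/-- Uniform second order Taylor expansions of `u` on the set `K`. -/
structure UniformTaylorOn (u : E → ℝ) (q : E → E →L[ℝ] ℝ) (H : E → E →L[ℝ] E) (K : Set E) :
    Prop where
  bdd : ∃ M, ∀ x ∈ K, ‖H x‖ ≤ M
  taylor : ∀ ε > 0, ∃ r > 0, ∀ x ∈ K, ∀ h : E, ‖h‖ ≤ r →
    |u (x + h) - u x - q x h - 1 / 2 * ⟪H x h, h⟫| ≤ ε * ‖h‖ ^ 2

/-- An Egorov-type selection of a compact set inside countably many exhaustions. -/
lemma exists_isCompact_subset_of_exhaustions {μ : Measure E} [μ.IsAddHaarMeasure]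
    {A : ℕ → ℕ → Set E} (hA : ∀ k m, MeasurableSet (A k m)) (hmono : ∀ k, Monotone (A k))
    (hae : ∀ k, ∀ᵐ x ∂μ, ∃ m, x ∈ A k m) {S : Set E} (hS : MeasurableSet S) (hSf : μ S ≠ ∞)
    {ε : ℝ≥0∞} (hε : ε ≠ 0) :
    ∃ K ⊆ S, IsCompact K ∧ μ (S \ K) < ε ∧ ∀ k, ∃ m, K ⊆ A k m := by
  obtain ⟨ε', hε'0, hε'⟩ := ENNReal.exists_pos_sum_of_countable' (ENNReal.half_pos hε).ne' ℕ
  have hex : ∀ k, ∃ m, μ (S \ A k m) < ε' k := by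
    intro k
    have h1 : Tendsto (μ ∘ fun m => S \ A k m) atTop (𝓝 (μ (⋂ m, S \ A k m))) := by
      refine tendsto_measure_iInter_atTop (fun m => (hS.diff (hA k m)).nullMeasurableSet) ?_
        ⟨0, ne_top_of_le_ne_top hSf (measure_mono sdiff_subset)⟩
      exact fun m m' h => sdiff_subset_sdiff_right (hmono k h)
    have h2 : μ (⋂ m, S \ A k m) = 0 := by
      refine measure_mono_null ?_ (hae k)
      intro x hx hx'
      obtain ⟨m, hm⟩ := hx'
      exact (mem_iInter.1 hx m).2 hm
    rw [h2] at h1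
    exact (h1.eventually_lt_const (hε'0 k)).exists
  choose φ hφ using hex
  have hmeas : MeasurableSet (S ∩ ⋂ k, A k (φ k)) := hS.inter (MeasurableSet.iInter fun k => hA _ _)
  obtain ⟨K, hK, hKc, hKμ⟩ := hmeas.exists_isCompact_sdiff_lt (μ := μ)
    (ne_top_of_le_ne_top hSf (measure_mono inter_subset_left)) (ENNReal.half_pos hε).ne'
  refine ⟨K, hK.trans inter_subset_left, hKc, ?_, fun k => ⟨φ k, ?_⟩⟩
  · have hsub : S \ K ⊆ ((S ∩ ⋂ k, A k (φ k)) \ K) ∪ ⋃ k, S \ A k (φ k) := by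
      intro x hx
      by_cases h : x ∈ ⋂ k, A k (φ k)
      · exact Or.inl ⟨⟨hx.1, h⟩, hx.2⟩
      · simp only [mem_iInter, not_forall] at h
        obtain ⟨k, hk⟩ := h
        exact Or.inr (mem_iUnion.2 ⟨k, hx.1, hk⟩)
    calc μ (S \ K) ≤ μ ((S ∩ ⋂ k, A k (φ k)) \ K) + μ (⋃ k, S \ A k (φ k)) :=
          (measure_mono hsub).trans (measure_union_le _ _)
      _ ≤ μ ((S ∩ ⋂ k, A k (φ k)) \ K) + ∑' k, ε' k := by
          gcongr
          exact (measure_iUnion_le _).trans (ENNReal.tsum_le_tsum fun k => (hφ k).le)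
      _ < ε / 2 + ε / 2 := ENNReal.add_lt_add hKμ hε'
      _ = ε := ENNReal.add_halves ε
  · exact hK.trans (inter_subset_right.trans (iInter_subset _ k))

lemma exists_isCompact_uniformTaylorOn {u : E → ℝ} (hu : Continuous u) {q : E → E →L[ℝ] ℝ}
    {H : E → E →L[ℝ] E} (hq : Measurable q) (hH : Measurable H) {μ : Measure E}
    [μ.IsAddHaarMeasure]
    (hae : ∀ᵐ x ∂μ, ∀ ε > 0, ∃ r > 0, ∀ h : E, ‖h‖ ≤ r →
        |u (x + h) - u x - q x h - 1 / 2 * ⟪H x h, h⟫| ≤ ε * ‖h‖ ^ 2)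
    {S : Set E} (hS : MeasurableSet S) (hSf : μ S ≠ ∞) {ε : ℝ≥0∞} (hε : ε ≠ 0) :
    ∃ K ⊆ S, IsCompact K ∧ μ (S \ K) < ε ∧ UniformTaylorOn u q H K := by
  set P : E → E → ℝ := fun x h => u (x + h) - u x - q x h - 1 / 2 * ⟪H x h, h⟫ with hP
  set A : ℕ → ℕ → Set E := fun k m => {x | ‖H x‖ ≤ m} ∩
    {x | ∀ h : E, ‖h‖ < 1 / ((m : ℝ) + 1) → |P x h| ≤ 1 / ((k : ℝ) + 1) * ‖h‖ ^ 2} with hAdef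
  have hPc : ∀ x, Continuous (P x) := fun x => by simp only [hP]; fun_prop
  have hPm : ∀ h, Measurable fun x => P x h := by
    intro h
    have h1 : Measurable fun x => q x h := (ContinuousLinearMap.apply ℝ ℝ h).measurable.comp hq
    have h2 : Measurable fun x => H x h := (ContinuousLinearMap.apply ℝ E h).measurable.comp hH
    have h3 : Measurable fun x => ⟪H x h, h⟫ := h2.inner measurable_const
    have h4 : Measurable fun x => u (x + h) := hu.measurable.comp (measurable_id.add_const h)
    exact ((h4.sub hu.measurable).sub h1).sub (h3.const_mul _)
  have hA : ∀ k m, MeasurableSet (A k m) := by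
    intro k m
    refine (measurableSet_le hH.norm measurable_const).inter ?_
    obtain ⟨D, hDc, hD⟩ := TopologicalSpace.exists_countable_dense E
    have : {x | ∀ h : E, ‖h‖ < 1 / ((m : ℝ) + 1) → |P x h| ≤ 1 / ((k : ℝ) + 1) * ‖h‖ ^ 2} =
        ⋂ h ∈ D ∩ ball 0 (1 / ((m : ℝ) + 1)), {x | |P x h| ≤ 1 / ((k : ℝ) + 1) * ‖h‖ ^ 2} := by
      ext x
      simp only [mem_ofPred_eq, mem_iInter]
      refine ⟨fun hx h hh => hx h (by simpa using hh.2), fun hx h hh => ?_⟩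
      have hcl : IsClosed {h | |P x h| ≤ 1 / ((k : ℝ) + 1) * ‖h‖ ^ 2} :=
        isClosed_le (hPc x).abs (by fun_prop)
      have hmem := hD.open_subset_closure_inter isOpen_ball
        (show h ∈ ball 0 (1 / ((m : ℝ) + 1)) by simpa using hh)
      exact (hcl.closure_subset_iff.2 fun y hy => hx y ⟨hy.2, hy.1⟩) hmem
    rw [this]
    refine MeasurableSet.biInter (hDc.mono inter_subset_left) fun h _ => ?_
    exact measurableSet_le (hPm h).abs measurable_const
  have hmono : ∀ k, Monotone (A k) := by
    intro k m m' hmm x hx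
    have hmm' : (m : ℝ) ≤ m' := by exact_mod_cast hmm
    refine ⟨le_trans hx.1 hmm', fun h hh => hx.2 h (hh.trans_le ?_)⟩
    gcongr
  have haeA : ∀ k, ∀ᵐ x ∂μ, ∃ m, x ∈ A k m := by
    intro k
    filter_upwards [hae] with x hx
    obtain ⟨r, hr, hx⟩ := hx (1 / ((k : ℝ) + 1)) (by positivity)
    obtain ⟨m, hm⟩ := exists_nat_gt (max ‖H x‖ (1 / r))
    have hm1 := (le_max_left _ _).trans hm.le
    have hm2 := (le_max_right _ _).trans hm.le
    refine ⟨m, hm1, fun h hh => hx h (hh.le.trans ?_)⟩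
    rw [div_le_iff₀ (by positivity)]
    rw [div_le_iff₀ hr] at hm2
    nlinarith
  obtain ⟨K, hKS, hKc, hKμ, hKA⟩ := exists_isCompact_subset_of_exhaustions hA hmono haeA hS hSf hε
  refine ⟨K, hKS, hKc, hKμ, ?_, fun ε hε => ?_⟩
  · obtain ⟨m, hm⟩ := hKA 0
    exact ⟨m, fun x hx => (hm hx).1⟩
  · obtain ⟨k, hk⟩ := exists_nat_gt (1 / ε)
    obtain ⟨m, hm⟩ := hKA k
    refine ⟨1 / ((m : ℝ) + 2), by positivity, fun x hx h hh => ?_⟩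
    refine ((hm hx).2 h (hh.trans_lt ?_)).trans ?_
    · exact one_div_lt_one_div_of_lt (by positivity) (by linarith)
    · gcongr
      rw [div_lt_iff₀ hε] at hk
      rw [div_le_iff₀ (by positivity)]
      nlinarith

end Alexandrov

section Jet

variable {E : Type*} [NormedAddCommGroup E] [NormedSpace ℝ E] {f g : E → ℝ} {x : E}
  {A B R : ℝ}

/-- Scale-invariant bound on the derivatives of `f` at `x` up to order two. -/
def JetBound (B R : ℝ) (f : E → ℝ) (x : E) : Prop :=
  ∀ k ≤ 2, ‖iteratedFDeriv ℝ k f x‖ * R ^ k ≤ B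

namespace JetBound

lemma nonneg (h : JetBound B R f x) : 0 ≤ B := by
  have := h 0 (by norm_num)
  exact (by positivity : (0 : ℝ) ≤ _).trans this

lemma abs_le (h : JetBound B R f x) : |f x| ≤ B := by
  simpa using h 0 (by norm_num)

lemma norm_fderiv_le (h : JetBound B R f x) : ‖fderiv ℝ f x‖ * R ≤ B := by
  simpa [norm_iteratedFDeriv_one] using h 1 (by norm_num)

lemma norm_iteratedFDeriv_two (f : E → ℝ) (x : E) :
    ‖iteratedFDeriv ℝ 2 f x‖ = ‖fderiv ℝ (fderiv ℝ f) x‖ := by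
  rw [← norm_iteratedFDeriv_fderiv, norm_iteratedFDeriv_one]

lemma norm_fderiv_fderiv_le (h : JetBound B R f x) : ‖fderiv ℝ (fderiv ℝ f) x‖ * R ^ 2 ≤ B := by
  simpa [norm_iteratedFDeriv_two] using h 2 le_rfl

lemma of_bounds (h0 : |f x| ≤ B) (h1 : ‖fderiv ℝ f x‖ * R ≤ B)
    (h2 : ‖fderiv ℝ (fderiv ℝ f) x‖ * R ^ 2 ≤ B) : JetBound B R f x := by
  intro k hk
  interval_cases k
  · simpa using h0
  · simpa [norm_iteratedFDeriv_one] using h1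
  · simpa [norm_iteratedFDeriv_two] using h2

lemma mono (h : JetBound A R f x) (hAB : A ≤ B) : JetBound B R f x :=
  fun k hk => (h k hk).trans hAB

lemma scale_le {R' c : ℝ} (h : JetBound B R f x) (hR : 0 ≤ R) (hR' : 0 ≤ R') (hc : 1 ≤ c)
    (hRR' : R' ≤ c * R) : JetBound (c ^ 2 * B) R' f x := by
  intro k hk
  calc ‖iteratedFDeriv ℝ k f x‖ * R' ^ k ≤ ‖iteratedFDeriv ℝ k f x‖ * (c * R) ^ k := by gcongr
    _ = c ^ k * (‖iteratedFDeriv ℝ k f x‖ * R ^ k) := by ring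
    _ ≤ c ^ 2 * B := by
      gcongr
      exact h k hk

lemma congr (h : JetBound B R f x) (hfg : f =ᶠ[𝓝 x] g) : JetBound B R g x :=
  fun k hk => by rw [← (hfg.iteratedFDeriv ℝ k).eq_of_nhds]; exact h k hk

lemma add (hf : JetBound A R f x) (hg : JetBound B R g x) (hR : 0 ≤ R) (hfc : ContDiff ℝ 2 f)
    (hgc : ContDiff ℝ 2 g) : JetBound (A + B) R (fun y => f y + g y) x := by
  intro k hk
  have hk' : (k : WithTop ℕ∞) ≤ 2 := by exact_mod_cast hk
  rw [fun_iteratedFDeriv_add_apply (hfc.of_le hk').contDiffAt (hgc.of_le hk').contDiffAt]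
  calc _ ≤ (‖iteratedFDeriv ℝ k f x‖ + ‖iteratedFDeriv ℝ k g x‖) * R ^ k := by
        gcongr; exact norm_add_le _ _
    _ ≤ _ := by rw [add_mul]; exact add_le_add (hf k hk) (hg k hk)

lemma neg (hf : JetBound A R f x) : JetBound A R (fun y => -f y) x := by
  intro k hk
  have : iteratedFDeriv ℝ k (fun y => -f y) x = -iteratedFDeriv ℝ k f x :=
    iteratedFDeriv_neg_apply
  rw [this, norm_neg]
  exact hf k hk

lemma sub (hf : JetBound A R f x) (hg : JetBound B R g x) (hR : 0 ≤ R) (hfc : ContDiff ℝ 2 f)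
    (hgc : ContDiff ℝ 2 g) : JetBound (A + B) R (fun y => f y - g y) x := by
  simpa [sub_eq_add_neg] using hf.add hg.neg hR hfc hgc.neg

lemma mul (hf : JetBound A R f x) (hg : JetBound B R g x) (hR : 0 ≤ R) (hfc : ContDiff ℝ 2 f)
    (hgc : ContDiff ℝ 2 g) : JetBound (4 * A * B) R (fun y => f y * g y) x := by
  intro k hk
  have hk' : (k : WithTop ℕ∞) ≤ 2 := by exact_mod_cast hk
  have hA := hf.nonneg
  have hB := hg.nonneg
  calc ‖iteratedFDeriv ℝ k (fun y => f y * g y) x‖ * R ^ k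
      ≤ (∑ i ∈ Finset.range (k + 1), (k.choose i : ℝ) * ‖iteratedFDeriv ℝ i f x‖ *
          ‖iteratedFDeriv ℝ (k - i) g x‖) * R ^ k := by
        gcongr; exact norm_iteratedFDeriv_mul_le hfc hgc x hk'
    _ = ∑ i ∈ Finset.range (k + 1), (k.choose i : ℝ) * ((‖iteratedFDeriv ℝ i f x‖ * R ^ i) *
          (‖iteratedFDeriv ℝ (k - i) g x‖ * R ^ (k - i))) := by
        rw [Finset.sum_mul]
        refine Finset.sum_congr rfl fun i hi => ?_
        have hik : i ≤ k := Nat.lt_succ_iff.1 (Finset.mem_range.1 hi)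
        have : R ^ k = R ^ i * R ^ (k - i) := by rw [← pow_add, Nat.add_sub_cancel' hik]
        rw [this]; ring
    _ ≤ ∑ i ∈ Finset.range (k + 1), (k.choose i : ℝ) * (A * B) := by
        refine Finset.sum_le_sum fun i hi => ?_
        have hik : i ≤ k := Nat.lt_succ_iff.1 (Finset.mem_range.1 hi)
        gcongr
        · exact hf i (hik.trans hk)
        · exact hg (k - i) ((Nat.sub_le _ _).trans hk)
    _ = 2 ^ k * (A * B) := by
        rw [← Finset.sum_mul]
        congr 1
        exact_mod_cast Nat.sum_range_choose k
    _ ≤ 2 ^ 2 * (A * B) := by gcongr; norm_num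
    _ = 4 * A * B := by ring

lemma comp_smul {a : ℝ} (ha : 0 < a) (h : JetBound B R f (a • x)) (hf : ContDiff ℝ 2 f) :
    JetBound B (a⁻¹ * R) (fun y => f (a • y)) x := by
  intro k hk
  have hk' : (k : WithTop ℕ∞) ≤ 2 := by exact_mod_cast hk
  rw [iteratedFDeriv_comp_const_smul a (hf.of_le hk'), norm_smul, norm_pow,
    Real.norm_of_nonneg ha.le]
  calc a ^ k * ‖iteratedFDeriv ℝ k f (a • x)‖ * (a⁻¹ * R) ^ k
      = ‖iteratedFDeriv ℝ k f (a • x)‖ * R ^ k := by rw [mul_pow, inv_pow]; field_simp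
    _ ≤ B := h k hk

lemma const (c : ℝ) (hc : |c| ≤ B) : JetBound B R (fun _ : E => c) x := by
  intro k _
  rcases eq_or_ne k 0 with rfl | hk
  · simpa using hc
  · rw [iteratedFDeriv_const_of_ne hk c, Pi.zero_apply, norm_zero, zero_mul]
    exact (abs_nonneg c).trans hc

end JetBound

end Jet

section QuadPoly

variable {E : Type*} [NormedAddCommGroup E] [InnerProductSpace ℝ E]

/-- A quadratic polynomial centered at `x₀`. -/
noncomputable def quadPoly (a : ℝ) (q : E →L[ℝ] ℝ) (H : E →L[ℝ] E) (x₀ : E) (y : E) : ℝ :=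
  a + q (y - x₀) + 1 / 2 * ⟪H (y - x₀), y - x₀⟫

lemma contDiff_quadPoly (a : ℝ) (q : E →L[ℝ] ℝ) (H : E →L[ℝ] E) (x₀ : E) {n : ℕ∞} :
    ContDiff ℝ n (quadPoly a q H x₀) := by
  have h : ContDiff ℝ n fun y => ⟪H (y - x₀), y - x₀⟫ :=
    (by fun_prop : ContDiff ℝ n fun y => H (y - x₀)).inner ℝ (by fun_prop)
  unfold quadPoly
  fun_prop

end QuadPoly

lemma norm_precompR_apply_le {E E₁ F₁ : Type*} [NormedAddCommGroup E]
    [NormedSpace ℝ E] [NormedAddCommGroup E₁] [NormedSpace ℝ E₁]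
    [NormedAddCommGroup F₁] [NormedSpace ℝ F₁] (L : ℝ →L[ℝ] E₁ →L[ℝ] F₁)
    (hL : ∀ a b, ‖L a b‖ ≤ |a| * ‖b‖) (a : ℝ) (b : E →L[ℝ] E₁) :
    ‖L.precompR E a b‖ ≤ |a| * ‖b‖ := by
  refine ContinuousLinearMap.opNorm_le_bound _ (by positivity) fun v => ?_
  rw [ContinuousLinearMap.precompR_apply, mul_assoc]
  exact (hL _ _).trans (mul_le_mul_of_nonneg_left (b.le_opNorm v) (abs_nonneg _))

section Mollifier

variable {E : Type*} [NormedAddCommGroup E] [InnerProductSpace ℝ E] [FiniteDimensional ℝ E]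
  [MeasurableSpace E] [BorelSpace E]

variable (E) in
/-- A smooth, symmetric probability density supported in the closed unit ball. -/
noncomputable def mollKernel : E → ℝ :=
  (⟨1 / 2, 1, by norm_num, by norm_num⟩ : ContDiffBump (0 : E)).normed volume

/-- Mollification of `f` at scale `δ`. -/
noncomputable def mollify (δ : ℝ) (f : E → ℝ) (x : E) : ℝ :=
  ∫ z, mollKernel E z * f (x - δ • z)

lemma mollKernel_nonneg (z : E) : 0 ≤ mollKernel E z := ContDiffBump.nonneg_normed _ z

lemma contDiff_mollKernel {n : ℕ∞} : ContDiff ℝ n (mollKernel E) := ContDiffBump.contDiff_normed _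

lemma continuous_mollKernel : Continuous (mollKernel E) := ContDiffBump.continuous_normed _

lemma integral_mollKernel : ∫ z, mollKernel E z = 1 := ContDiffBump.integral_normed _

lemma mollKernel_neg (z : E) : mollKernel E (-z) = mollKernel E z := ContDiffBump.normed_neg _ z

lemma hasCompactSupport_mollKernel : HasCompactSupport (mollKernel E) :=
  ContDiffBump.hasCompactSupport_normed _

lemma tsupport_mollKernel : tsupport (mollKernel E) = closedBall 0 1 :=
  ContDiffBump.tsupport_normed_eq _

lemma mollKernel_eq_zero {z : E} (hz : 1 < ‖z‖) : mollKernel E z = 0 := by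
  refine image_eq_zero_of_notMem_tsupport ?_
  rw [tsupport_mollKernel]
  simpa using hz

lemma integrable_mollKernel_mul {f : E → ℝ} (hf : Continuous f) :
    Integrable fun z => mollKernel E z * f z :=
  (continuous_mollKernel.mul hf).integrable_of_hasCompactSupport
    (hasCompactSupport_mollKernel.mul_right)

lemma integral_mollKernel_mul_const (c : ℝ) : ∫ z, mollKernel E z * c = c := by
  rw [integral_mul_const, integral_mollKernel, one_mul]

lemma integral_mollKernel_mul_mono {f g : E → ℝ} (hf : Continuous f) (hg : Continuous g)
    (h : ∀ z, ‖z‖ ≤ 1 → f z ≤ g z) :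
    ∫ z, mollKernel E z * f z ≤ ∫ z, mollKernel E z * g z := by
  refine integral_mono (integrable_mollKernel_mul hf) (integrable_mollKernel_mul hg) fun z => ?_
  by_cases hz : ‖z‖ ≤ 1
  · exact mul_le_mul_of_nonneg_left (h z hz) (mollKernel_nonneg z)
  · simp [mollKernel_eq_zero (not_le.1 hz)]

lemma abs_integral_mollKernel_mul_le {f : E → ℝ} (hf : Continuous f) {B : ℝ}
    (h : ∀ z, ‖z‖ ≤ 1 → |f z| ≤ B) : |∫ z, mollKernel E z * f z| ≤ B := by
  rw [abs_le]
  constructor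
  · rw [← integral_mollKernel_mul_const (E := E) (-B)]
    exact integral_mollKernel_mul_mono continuous_const hf fun z hz => (abs_le.1 (h z hz)).1
  · conv_rhs => rw [← integral_mollKernel_mul_const (E := E) B]
    exact integral_mollKernel_mul_mono hf continuous_const fun z hz => (abs_le.1 (h z hz)).2

lemma integral_mollKernel_mul_odd {f : E → ℝ} (h : ∀ z, f (-z) = -f z) :
    ∫ z, mollKernel E z * f z = 0 := by
  have h1 : ∫ z, mollKernel E (-z) * f (-z) = ∫ z, mollKernel E z * f z :=
    integral_neg_eq_self (fun z => mollKernel E z * f z) volume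
  simp only [mollKernel_neg, h, mul_neg, integral_neg] at h1
  linarith

lemma mollify_comp_smul (δ : ℝ) (hδ : δ ≠ 0) (f : E → ℝ) (x : E) :
    mollify δ f x = mollify 1 (fun y => f (δ • y)) (δ⁻¹ • x) := by
  simp only [mollify, one_smul, smul_sub, smul_smul, mul_inv_cancel₀ hδ]

lemma mollify_eq_convolution {δ : ℝ} (hδ : 0 < δ) (f : E → ℝ) (x : E) :
    mollify δ f x = convolution f (fun w => (δ ^ Module.finrank ℝ E)⁻¹ * mollKernel E (δ⁻¹ • w))
      (ContinuousLinearMap.mul ℝ ℝ) volume x := by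
  simp only [convolution, ContinuousLinearMap.mul_apply']
  rw [← integral_sub_left_eq_self _ volume x]
  simp only [sub_sub_cancel]
  have := Measure.integral_comp_smul volume
    (fun t => f (x - t) * ((δ ^ Module.finrank ℝ E)⁻¹ * mollKernel E (δ⁻¹ • t))) δ
  rw [abs_of_pos (by positivity), smul_eq_mul, eq_inv_mul_iff_mul_eq₀ (by positivity),
    ← integral_const_mul] at this
  rw [← this]
  refine integral_congr_ae (Eventually.of_forall fun z => ?_)
  simp only [smul_smul, inv_mul_cancel₀ hδ.ne', one_smul]
  field_simp

lemma mollify_one (f : E → ℝ) (x : E) :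
    mollify 1 f x = convolution f (mollKernel E) (ContinuousLinearMap.mul ℝ ℝ) volume x := by
  simpa using mollify_eq_convolution one_pos f x

lemma contDiff_mollify {δ : ℝ} (hδ : 0 < δ) {f : E → ℝ} (hf : Continuous f) {n : ℕ∞} :
    ContDiff ℝ n (mollify δ f) := by
  have h1 : ContDiff ℝ n (mollify 1 fun y => f (δ • y)) := by
    have : mollify 1 (fun y => f (δ • y)) = convolution (fun y => f (δ • y)) (mollKernel E)
      (ContinuousLinearMap.mul ℝ ℝ) volume := funext (mollify_one _)
    rw [this]
    refine hasCompactSupport_mollKernel.contDiff_convolution_right _ ?_ contDiff_mollKernel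
    exact (by fun_prop : Continuous fun y => f (δ • y)).locallyIntegrable
  have h2 : mollify δ f = fun x => mollify 1 (fun y => f (δ • y)) (δ⁻¹ • x) :=
    funext (mollify_comp_smul δ hδ.ne' f)
  rw [h2]
  exact h1.comp (contDiff_const_smul _)

/-- Joint smoothness of the mollification in the scale and the point. -/
lemma contDiffOn_mollify_param {f : E → ℝ} (hf : Continuous f) {n : ℕ∞} :
    ContDiffOn ℝ n (fun q : ℝ × E => mollify q.1 f q.2) (Ioi 0 ×ˢ univ) := by
  rintro ⟨δ, x⟩ ⟨hδ, -⟩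
  have hδ : 0 < δ := hδ
  have hs : IsOpen (Ioo (0 : ℝ) (2 * δ)) := isOpen_Ioo
  have hc := contDiffOn_convolution_right_with_param (n := n) (μ := (volume : Measure E))
    (f := f) (ContinuousLinearMap.mul ℝ ℝ)
    (g := fun (d : ℝ) (w : E) => (d ^ Module.finrank ℝ E)⁻¹ * mollKernel E (d⁻¹ • w))
    (k := closedBall 0 (2 * δ)) hs (isCompact_closedBall _ _) ?_ hf.locallyIntegrable ?_
  · have hmem : Ioo (0 : ℝ) (2 * δ) ×ˢ (univ : Set E) ∈ 𝓝 (δ, x) :=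
      (hs.prod isOpen_univ).mem_nhds ⟨⟨hδ, by linarith⟩, mem_univ _⟩
    refine ((hc.contDiffAt hmem).congr_of_eventuallyEq ?_).contDiffWithinAt
    filter_upwards [hmem] with q hq
    exact mollify_eq_convolution hq.1.1 f q.2
  · intro d w hd hw
    rw [mollKernel_eq_zero, mul_zero]
    rw [norm_smul, norm_inv, Real.norm_of_nonneg hd.1.le]
    simp only [mem_closedBall, dist_zero_right, not_le] at hw
    rw [inv_mul_eq_div, one_lt_div hd.1]
    exact hd.2.trans hw
  · refine ContDiffOn.mul (ContDiffOn.inv (by fun_prop) ?_) ?_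
    · rintro ⟨d, w⟩ hd
      exact pow_ne_zero _ hd.1.1.ne'
    · refine contDiff_mollKernel.comp_contDiffOn (ContDiffOn.smul (ContDiffOn.inv (by fun_prop) ?_)
        (by fun_prop))
      rintro ⟨d, w⟩ hd
      exact hd.1.1.ne'

lemma norm_convolution_le {E₁ F₁ : Type*} [NormedAddCommGroup E₁] [NormedSpace ℝ E₁]
    [NormedAddCommGroup F₁] [NormedSpace ℝ F₁] (L : ℝ →L[ℝ] E₁ →L[ℝ] F₁)
    (hL : ∀ a b, ‖L a b‖ ≤ |a| * ‖b‖) {f : E → ℝ} {g : E → E₁} (hg : Continuous g)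
    (hgs : tsupport g ⊆ closedBall 0 1) {x : E} {B : ℝ} (hB : ∀ y ∈ closedBall x 1, |f y| ≤ B) :
    ‖convolution f g L volume x‖ ≤ (∫ z, ‖g z‖) * B := by
  have hB0 : 0 ≤ B := (abs_nonneg _).trans (hB x (by simp))
  have hgc : HasCompactSupport g := (isCompact_closedBall (0 : E) 1).of_isClosed_subset
    (isClosed_tsupport g) hgs
  have hgi : Integrable fun z => ‖g z‖ := (hg.integrable_of_hasCompactSupport hgc).norm
  have h1 : ∀ t, ‖L (f t) (g (x - t))‖ ≤ B * ‖g (x - t)‖ := by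
    intro t
    by_cases ht : x - t ∈ tsupport g
    · have ht' : t ∈ closedBall x 1 := by
        have := hgs ht
        rw [mem_closedBall, dist_zero_right] at this
        rwa [mem_closedBall, dist_eq_norm, norm_sub_rev]
      exact (hL _ _).trans (mul_le_mul_of_nonneg_right (hB t ht') (norm_nonneg _))
    · rw [image_eq_zero_of_notMem_tsupport ht]; simp
  calc ‖convolution f g L volume x‖ ≤ ∫ t, ‖L (f t) (g (x - t))‖ := norm_integral_le_integral_norm _
    _ ≤ ∫ t, B * ‖g (x - t)‖ := by
        refine integral_mono_of_nonneg (Eventually.of_forall fun t => norm_nonneg _) ?_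
          (Eventually.of_forall h1)
        exact (hgi.comp_sub_left x).const_mul B
    _ = (∫ z, ‖g z‖) * B := by
        rw [integral_const_mul, integral_sub_left_eq_self (fun z => ‖g z‖) volume x, mul_comm]

lemma norm_fderiv_convolution_le {E₁ F₁ : Type*} [NormedAddCommGroup E₁] [NormedSpace ℝ E₁]
    [NormedAddCommGroup F₁] [NormedSpace ℝ F₁] (L : ℝ →L[ℝ] E₁ →L[ℝ] F₁)
    (hL : ∀ a b, ‖L a b‖ ≤ |a| * ‖b‖) {f : E → ℝ} (hf : Continuous f) {g : E → E₁}
    (hg : ContDiff ℝ 1 g) (hgs : tsupport g ⊆ closedBall 0 1) {x : E} {B : ℝ}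
    (hB : ∀ y ∈ closedBall x 1, |f y| ≤ B) :
    ‖fderiv ℝ (convolution f g L volume) x‖ ≤ (∫ z, ‖fderiv ℝ g z‖) * B := by
  have hgc : HasCompactSupport g := (isCompact_closedBall (0 : E) 1).of_isClosed_subset
    (isClosed_tsupport g) hgs
  rw [(hgc.hasFDerivAt_convolution_right L hf.locallyIntegrable hg x).fderiv]
  exact norm_convolution_le _ (norm_precompR_apply_le L hL)
    (hg.continuous_fderiv (by norm_num)) ((tsupport_fderiv_subset ℝ).trans hgs) hB

/-- Derivatives of mollifications are controlled by the supremum of the function. -/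
lemma exists_jetBound_mollify : ∃ C : ℝ, 1 ≤ C ∧ ∀ (f : E → ℝ), Continuous f → ∀ (δ : ℝ), 0 < δ →
    ∀ (x : E) (B : ℝ), (∀ y ∈ closedBall x δ, |f y| ≤ B) → JetBound (C * B) δ (mollify δ f) x := by
  set ρ := mollKernel E
  set c1 := ∫ z, ‖fderiv ℝ ρ z‖
  set c2 := ∫ z, ‖fderiv ℝ (fderiv ℝ ρ) z‖
  have hc1 : 0 ≤ c1 := by positivity
  have hc2 : 0 ≤ c2 := by positivity
  have hρ2 : ContDiff ℝ 2 ρ := contDiff_mollKernel (n := 2)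
  have hρ1 : ContDiff ℝ 1 (fderiv ℝ ρ) := hρ2.fderiv_right (by norm_num)
  have key : ∀ (f : E → ℝ), Continuous f → ∀ (x : E) (B : ℝ), (∀ y ∈ closedBall x 1, |f y| ≤ B) →
      JetBound ((1 + c1 + c2) * B) 1 (mollify 1 f) x := by
    intro f hf x B hB
    have hB0 : 0 ≤ B := (abs_nonneg _).trans (hB x (by simp))
    have hfun : mollify 1 f = convolution f ρ (ContinuousLinearMap.mul ℝ ℝ) volume :=
      funext (mollify_one f)
    have hd1 : fderiv ℝ (mollify 1 f) = convolution f (fderiv ℝ ρ)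
        ((ContinuousLinearMap.mul ℝ ℝ).precompR E) volume := by
      ext1 y
      rw [hfun]
      exact (hasCompactSupport_mollKernel.hasFDerivAt_convolution_right _ hf.locallyIntegrable
        (hρ2.of_le (by norm_num)) y).fderiv
    have hL0 : ∀ a b, ‖ContinuousLinearMap.mul ℝ ℝ a b‖ ≤ |a| * ‖b‖ := fun a b => by
      simp
    have hL1 := norm_precompR_apply_le (E := E) (ContinuousLinearMap.mul ℝ ℝ) hL0
    have ht0 : tsupport ρ ⊆ closedBall 0 1 := tsupport_mollKernel.le
    have ht1 : tsupport (fderiv ℝ ρ) ⊆ closedBall 0 1 := (tsupport_fderiv_subset ℝ).trans ht0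
    refine JetBound.of_bounds ?_ ?_ ?_
    · refine (abs_integral_mollKernel_mul_le (by fun_prop) (B := B) fun z hz => ?_).trans ?_
      · exact hB _ (by simpa [dist_eq_norm] using hz)
      · nlinarith
    · rw [hfun, mul_one]
      refine (norm_fderiv_convolution_le _ hL0 hf (hρ2.of_le (by norm_num)) ht0 hB).trans ?_
      gcongr
      change c1 ≤ _
      linarith
    · rw [hd1, one_pow, mul_one]
      refine (norm_fderiv_convolution_le _ hL1 hf hρ1 ht1 hB).trans ?_
      gcongr
      change c2 ≤ _
      linarith
  refine ⟨1 + c1 + c2, by linarith, fun f hf δ hδ x B hB => ?_⟩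
  have h1 := key (fun y => f (δ • y)) (by fun_prop) (δ⁻¹ • x) B fun y hy => ?_
  · have h2 := h1.comp_smul (inv_pos.2 hδ) (contDiff_mollify one_pos (by fun_prop) (n := 2))
    rw [inv_inv, mul_one] at h2
    refine h2.congr (Eventually.of_forall fun y => (mollify_comp_smul δ hδ.ne' f y).symm)
  · refine hB _ ?_
    rw [mem_closedBall, dist_eq_norm] at hy ⊢
    calc ‖δ • y - x‖ = ‖δ • (y - δ⁻¹ • x)‖ := by
          rw [smul_sub, smul_smul, mul_inv_cancel₀ hδ.ne', one_smul]
      _ = δ * ‖y - δ⁻¹ • x‖ := by rw [norm_smul, Real.norm_of_nonneg hδ.le]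
      _ ≤ δ * 1 := by gcongr
      _ = δ := mul_one δ

/-- Mollifying a quadratic polynomial only adds a small constant. -/
lemma mollify_quadPoly (a : ℝ) (q : E →L[ℝ] ℝ) (H : E →L[ℝ] E) (x₀ : E) (δ : ℝ) :
    ∃ c, |c| ≤ δ ^ 2 * ‖H‖ ∧ ∀ x, mollify δ (quadPoly a q H x₀) x = quadPoly a q H x₀ x + c := by
  refine ⟨∫ z : E, mollKernel E z * (δ ^ 2 * (1 / 2 * ⟪H z, z⟫)), ?_, fun x => ?_⟩
  · refine abs_integral_mollKernel_mul_le (by fun_prop) fun z hz => ?_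
    rw [abs_mul, abs_of_nonneg (sq_nonneg δ)]
    gcongr
    rw [abs_mul, abs_of_nonneg (by norm_num : (0 : ℝ) ≤ 1 / 2)]
    have h1 : |⟪H z, z⟫| ≤ ‖H‖ := by
      calc |⟪H z, z⟫| ≤ ‖H z‖ * ‖z‖ := abs_real_inner_le_norm _ _
        _ ≤ (‖H‖ * ‖z‖) * ‖z‖ := by gcongr; exact H.le_opNorm z
        _ ≤ (‖H‖ * 1) * 1 := by gcongr
        _ = ‖H‖ := by ring
    have := norm_nonneg H
    linarith
  · have hexp : ∀ z, mollKernel E z * quadPoly a q H x₀ (x - δ • z) =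
        mollKernel E z * quadPoly a q H x₀ x + mollKernel E z * (δ ^ 2 * (1 / 2 * ⟪H z, z⟫)) +
        mollKernel E z * (-δ * (q z + 1 / 2 * (⟪H (x - x₀), z⟫ + ⟪H z, x - x₀⟫))) := by
      intro z
      have hx : x - δ • z - x₀ = (x - x₀) - δ • z := by abel
      simp only [quadPoly, hx, map_sub, map_smul, inner_sub_left, inner_sub_right,
        real_inner_smul_left, real_inner_smul_right, smul_eq_mul]
      ring
    simp only [mollify, hexp]
    rw [integral_add, integral_add, integral_mollKernel_mul_const,
      integral_mollKernel_mul_odd (f := fun z => -δ * (q z + 1 / 2 * (⟪H (x - x₀), z⟫ +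
        ⟪H z, x - x₀⟫))), add_zero]
    · intro z
      simp only [map_neg, inner_neg_right, inner_neg_left]
      ring
    · exact integrable_mollKernel_mul (by fun_prop)
    · exact integrable_mollKernel_mul (by fun_prop)
    · exact (integrable_mollKernel_mul (by fun_prop)).add (integrable_mollKernel_mul (by fun_prop))
    · exact integrable_mollKernel_mul (by fun_prop)

lemma mollify_sub (δ : ℝ) {f g : E → ℝ} (hf : Continuous f) (hg : Continuous g) (x : E) :
    mollify δ (fun y => f y - g y) x = mollify δ f x - mollify δ g x := by
  simp only [mollify, mul_sub]
  exact integral_sub (integrable_mollKernel_mul (f := fun z => f (x - δ • z)) (by fun_prop))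
    (integrable_mollKernel_mul (f := fun z => g (x - δ • z)) (by fun_prop))

end Mollifier

section Hessian

variable {E : Type*} [NormedAddCommGroup E] [InnerProductSpace ℝ E]

/-- The Hessian of `f` at `x` is bounded below by `c`. -/
def HessGE (f : E → ℝ) (x : E) (c : ℝ) : Prop :=
  ∀ v, c * ‖v‖ ^ 2 ≤ fderiv ℝ (fderiv ℝ f) x v v

lemma HessGE.mono {f : E → ℝ} {x : E} {c c' : ℝ} (h : HessGE f x c) (hc : c' ≤ c) :
    HessGE f x c' := fun v => (by gcongr : c' * ‖v‖ ^ 2 ≤ c * ‖v‖ ^ 2).trans (h v)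

lemma HessGE.congr {f g : E → ℝ} {x : E} {c : ℝ} (h : HessGE f x c) (hfg : f =ᶠ[𝓝 x] g) :
    HessGE g x c := fun v => by rw [← hfg.fderiv.fderiv_eq]; exact h v

lemma HessGE.add {f g : E → ℝ} {x : E} {c e : ℝ} (h : HessGE f x c) (hf : ContDiff ℝ 2 f)
    (hg : ContDiff ℝ 2 g) (hge : ‖fderiv ℝ (fderiv ℝ g) x‖ ≤ e) :
    HessGE (fun y => f y + g y) x (c - e) := fun v => by
  have h1 : fderiv ℝ (fun y => f y + g y) = fun y => fderiv ℝ f y + fderiv ℝ g y := by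
    ext1 y
    exact fderiv_fun_add (hf.differentiable (by norm_num) y) (hg.differentiable (by norm_num) y)
  have hf' : Differentiable ℝ (fderiv ℝ f) :=
    (hf.fderiv_right (m := 1) (by norm_num)).differentiable (by norm_num)
  have hg' : Differentiable ℝ (fderiv ℝ g) :=
    (hg.fderiv_right (m := 1) (by norm_num)).differentiable (by norm_num)
  rw [h1, fderiv_fun_add (hf' x) (hg' x)]
  have h2 : |fderiv ℝ (fderiv ℝ g) x v v| ≤ e * ‖v‖ * ‖v‖ :=
    ((fderiv ℝ (fderiv ℝ g) x).le_opNorm₂ v v).trans (by gcongr)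
  have := h v
  have := (abs_le.1 h2).1
  simp only [add_apply]
  nlinarith

lemma hasDerivAt_line {f : E → ℝ} (hf : Differentiable ℝ f) (x v : E) (t : ℝ) :
    HasDerivAt (fun t : ℝ => f (x + t • v)) (fderiv ℝ f (x + t • v) v) t := by
  have h1 : HasDerivAt (fun t : ℝ => x + t • v) v t := by
    simpa using ((hasDerivAt_id t).smul_const v).const_add x
  exact (hf (x + t • v)).hasFDerivAt.comp_hasDerivAt t h1

lemma hasDerivAt_fderiv_line {f : E → ℝ} (hf : ContDiff ℝ 2 f) (x v : E) (t : ℝ) :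
    HasDerivAt (fun t : ℝ => fderiv ℝ f (x + t • v) v) (fderiv ℝ (fderiv ℝ f) (x + t • v) v v)
      t := by
  have hf' : Differentiable ℝ (fderiv ℝ f) :=
    (hf.fderiv_right (m := 1) (by norm_num)).differentiable (by norm_num)
  have h1 : HasDerivAt (fun t : ℝ => x + t • v) v t := by
    simpa using ((hasDerivAt_id t).smul_const v).const_add x
  have h2 := (hf' (x + t • v)).hasFDerivAt.comp_hasDerivAt t h1
  exact ((ContinuousLinearMap.apply ℝ ℝ v).hasFDerivAt.comp_hasDerivAt t h2)

lemma strongConvexOn_of_hessGE {f : E → ℝ} (hf : ContDiff ℝ 2 f) {c : ℝ}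
    (h : ∀ x, HessGE f x c) : StrongConvexOn univ c f := by
  rw [strongConvexOn_iff_convex]
  refine ⟨convex_univ, fun x _ y _ a b ha hb hab => ?_⟩
  set v := y - x with hv
  set φ : ℝ → ℝ := fun t => f (x + t • v) - c / 2 * ‖x + t • v‖ ^ 2 with hφ
  have hd1 : ∀ t, HasDerivAt φ (fderiv ℝ f (x + t • v) v - c * ⟪x + t • v, v⟫) t := by
    intro t
    have h1 : HasDerivAt (fun t : ℝ => x + t • v) v t := by
      simpa using ((hasDerivAt_id t).smul_const v).const_add x
    have h2 := (h1.norm_sq).const_mul (c / 2)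
    exact ((hasDerivAt_line (hf.differentiable (by norm_num)) x v t).sub h2).congr_deriv (by ring)
  have hd1' : deriv φ = fun t => fderiv ℝ f (x + t • v) v - c * ⟪x + t • v, v⟫ :=
    funext fun t => (hd1 t).deriv
  have hd2 : ∀ t, HasDerivAt (deriv φ)
      (fderiv ℝ (fderiv ℝ f) (x + t • v) v v - c * ⟪v, v⟫) t := by
    intro t
    rw [hd1']
    have h1 : HasDerivAt (fun t : ℝ => x + t • v) v t := by
      simpa using ((hasDerivAt_id t).smul_const v).const_add x
    have h2 := (h1.inner ℝ (hasDerivAt_const t v)).const_mul c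
    exact ((hasDerivAt_fderiv_line hf x v t).sub h2).congr_deriv (by simp)
  have hconv : ConvexOn ℝ univ φ := by
    refine convexOn_univ_of_deriv2_nonneg (fun t => (hd1 t).differentiableAt)
      (fun t => (hd2 t).differentiableAt) fun t => ?_
    rw [Function.iterate_succ, Function.iterate_one, Function.comp_apply, (hd2 t).deriv,
      real_inner_self_eq_norm_sq]
    exact sub_nonneg.2 (h _ v)
  have h0 := hconv.2 (mem_univ 0) (mem_univ 1) ha hb hab
  have e1 : x + (a • (0 : ℝ) + b • (1 : ℝ)) • v = a • x + b • y := by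
    rw [hv, eq_sub_of_add_eq hab]
    simp only [smul_eq_mul, mul_zero, mul_one, zero_add, smul_sub, sub_smul, one_smul]
    abel
  simp only [hφ] at h0
  rw [e1] at h0
  simpa [hv] using h0

lemma hessGE_of_strongConvexOn_ball {f : E → ℝ} (hf : ContDiff ℝ 2 f) {c r : ℝ} (hr : 0 < r)
    {x : E} (h : StrongConvexOn (ball x r) c f) : HessGE f x c := by
  intro v
  by_contra! hlt
  set ψ : ℝ → ℝ := fun t => f (x + t • v) + f (x + t • -v) - c * ‖v‖ ^ 2 * t ^ 2 with hψ
  have hfd := hf.differentiable (by norm_num)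
  have hd1 : ∀ t, HasDerivAt ψ (fderiv ℝ f (x + t • v) v + fderiv ℝ f (x + t • -v) (-v) -
      2 * c * ‖v‖ ^ 2 * t) t := fun t =>
    (((hasDerivAt_line hfd x v t).add (hasDerivAt_line hfd x (-v) t)).sub
      ((hasDerivAt_pow 2 t).const_mul (c * ‖v‖ ^ 2))).congr_deriv (by simp; ring)
  have hd1' : deriv ψ = fun t => fderiv ℝ f (x + t • v) v + fderiv ℝ f (x + t • -v) (-v) -
      2 * c * ‖v‖ ^ 2 * t := funext fun t => (hd1 t).deriv
  have hd2 : HasDerivAt (deriv ψ)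
      (2 * (fderiv ℝ (fderiv ℝ f) x v v - c * ‖v‖ ^ 2)) 0 := by
    rw [hd1']
    exact (((hasDerivAt_fderiv_line hf x v 0).add (hasDerivAt_fderiv_line hf x (-v) 0)).sub
      ((hasDerivAt_id (0 : ℝ)).const_mul (2 * c * ‖v‖ ^ 2))).congr_deriv (by simp; ring)
  have hmax : IsLocalMax ψ 0 := isLocalMax_of_deriv_deriv_neg
    (by rw [hd2.deriv]; linarith) (by simp [hd1']) (hd1 0).continuousAt
  have hmin : ∀ᶠ t in 𝓝 (0 : ℝ), ψ 0 ≤ ψ t := by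
    have h1 : ∀ᶠ t in 𝓝 (0 : ℝ), x + t • v ∈ ball x r :=
      (by fun_prop : Continuous fun t : ℝ => x + t • v).continuousAt.eventually_mem
        (by simpa using ball_mem_nhds x hr)
    have h2 : ∀ᶠ t in 𝓝 (0 : ℝ), x + t • -v ∈ ball x r :=
      (by fun_prop : Continuous fun t : ℝ => x + t • -v).continuousAt.eventually_mem
        (by simpa using ball_mem_nhds x hr)
    filter_upwards [h1, h2] with t ht1 ht2
    have h3 := h.apply_combo_le ht1 ht2 (a := 1 / 2) (b := 1 / 2) (by norm_num) (by norm_num)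
      (by norm_num)
    have e1 : (1 / 2 : ℝ) • (x + t • v) + (1 / 2 : ℝ) • (x + t • -v) = x := by
      module
    have e2 : x + t • v - (x + t • -v) = (2 * t) • v := by module
    rw [e1, e2, norm_smul, mul_pow, Real.norm_eq_abs, sq_abs] at h3
    simp only [hψ, zero_smul, add_zero]
    nlinarith
  have hconst : ψ =ᶠ[𝓝 0] fun _ => ψ 0 := by
    filter_upwards [hmax, hmin] with t h1 h2 using le_antisymm h1 h2
  have h0 := hconst.deriv.deriv_eq
  rw [hd2.deriv] at h0
  simp only [deriv_const'] at h0
  linarith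

end Hessian

section VariableScale

variable {E : Type*} [NormedAddCommGroup E] [InnerProductSpace ℝ E] [FiniteDimensional ℝ E]
  [MeasurableSpace E] [BorelSpace E]

lemma integral_mollKernel_mul_combo {f g : E → ℝ} (hf : Continuous f) (hg : Continuous g)
    (a b e : ℝ) : ∫ z, mollKernel E z * (a * f z + b * g z - e) =
      a * (∫ z, mollKernel E z * f z) + b * (∫ z, mollKernel E z * g z) - e := by
  have h : ∀ z, mollKernel E z * (a * f z + b * g z - e) =
      (a * (mollKernel E z * f z) + b * (mollKernel E z * g z)) - mollKernel E z * e :=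
    fun z => by ring
  have i1 : Integrable fun z => a * (mollKernel E z * f z) :=
    (integrable_mollKernel_mul hf).const_mul a
  have i2 : Integrable fun z => b * (mollKernel E z * g z) :=
    (integrable_mollKernel_mul hg).const_mul b
  have i3 : Integrable fun z => a * (mollKernel E z * f z) + b * (mollKernel E z * g z) :=
    i1.add i2
  simp only [h]
  rw [integral_sub i3 (integrable_mollKernel_mul continuous_const), integral_add i1 i2,
    integral_mollKernel_mul_const, integral_const_mul, integral_const_mul]

/-- Mollification with a slowly varying scale almost preserves strong convexity. -/
lemma StrongConvexOn.mollify_param {η : ℝ} {u : E → ℝ} (hu : StrongConvexOn univ η u) (hη : 0 ≤ η)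
    {s T : Set E} (hs : Convex ℝ s) (hT : Convex ℝ T) {δ : E → ℝ} {l m L : ℝ}
    (hl : l ≤ 1) (hL0 : 0 ≤ L)
    (hδl : ∀ x ∈ s, ∀ y ∈ s, |δ x - δ y| ≤ l * ‖x - y‖)
    (hδm : ∀ x ∈ s, ∀ y ∈ s, ∀ a b : ℝ, 0 ≤ a → 0 ≤ b → a + b = 1 →
      |a * δ x + b * δ y - δ (a • x + b • y)| ≤ m * (a * b * ‖x - y‖ ^ 2))
    (hsT : ∀ x ∈ s, ∀ z : E, ‖z‖ ≤ 1 → x - δ x • z ∈ T)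
    (hL : ∀ x ∈ T, ∀ y ∈ T, |u x - u y| ≤ L * ‖x - y‖) :
    StrongConvexOn s (η * (1 - l) ^ 2 - 2 * L * m) fun x => mollify (δ x) u x := by
  refine ⟨hs, fun x hx y hy a b ha hb hab => ?_⟩
  have huc := hu.continuous hη
  set w := a • x + b • y with hw
  set e := a * b * ((η * (1 - l) ^ 2 - 2 * L * m) / 2 * ‖x - y‖ ^ 2) with he
  have hws : w ∈ s := hs hx hy ha hb hab
  have key : ∀ z : E, ‖z‖ ≤ 1 →
      u (w - δ w • z) ≤ a * u (x - δ x • z) + b * u (y - δ y • z) - e := by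
    intro z hz
    set p := a • (x - δ x • z) + b • (y - δ y • z) with hp
    have hpT : p ∈ T := hT (hsT x hx z hz) (hsT y hy z hz) ha hb hab
    have h1 := hu.apply_combo_le (mem_univ (x - δ x • z)) (mem_univ (y - δ y • z)) ha hb hab
    have h2 : u (w - δ w • z) - u p ≤ L * (m * (a * b * ‖x - y‖ ^ 2)) := by
      refine (le_abs_self _).trans ((hL _ (hsT w hws z hz) _ hpT).trans ?_)
      gcongr
      have e1 : w - δ w • z - p = (a * δ x + b * δ y - δ w) • z := by
        rw [hw, hp]; module
      rw [e1, norm_smul, Real.norm_eq_abs]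
      calc _ ≤ |a * δ x + b * δ y - δ w| * 1 := by gcongr
        _ ≤ _ := by rw [mul_one]; exact hδm x hx y hy a b ha hb hab
    have h3 : (1 - l) * ‖x - y‖ ≤ ‖x - δ x • z - (y - δ y • z)‖ := by
      have e2 : x - δ x • z - (y - δ y • z) = (x - y) - (δ x - δ y) • z := by module
      rw [e2]
      have h4 : ‖(δ x - δ y) • z‖ ≤ l * ‖x - y‖ := by
        rw [norm_smul, Real.norm_eq_abs]
        calc _ ≤ |δ x - δ y| * 1 := by gcongr
          _ ≤ _ := by rw [mul_one]; exact hδl x hx y hy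
      have := norm_sub_norm_le (x - y) ((δ x - δ y) • z)
      linarith
    have h5 : (1 - l) ^ 2 * ‖x - y‖ ^ 2 ≤ ‖x - δ x • z - (y - δ y • z)‖ ^ 2 := by
      rw [← mul_pow]
      have : 0 ≤ (1 - l) * ‖x - y‖ := mul_nonneg (by linarith) (norm_nonneg _)
      gcongr
    have h6 : a * b * (η / 2) * ((1 - l) ^ 2 * ‖x - y‖ ^ 2) ≤
        a * b * (η / 2) * ‖x - δ x • z - (y - δ y • z)‖ ^ 2 := by gcongr
    rw [he]
    linarith
  have hmono := integral_mollKernel_mul_mono (E := E) (f := fun z => u (w - δ w • z))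
    (g := fun z => a * u (x - δ x • z) + b * u (y - δ y • z) - e) (by fun_prop) (by fun_prop) key
  rwa [integral_mollKernel_mul_combo (by fun_prop) (by fun_prop)] at hmono

lemma strongConvexOn_mollify {η : ℝ} {u : E → ℝ} (hu : StrongConvexOn univ η u) (hη : 0 ≤ η)
    (δ : ℝ) : StrongConvexOn univ η (mollify δ u) := by
  refine ⟨convex_univ, fun x _ y _ a b ha hb hab => ?_⟩
  have huc := hu.continuous hη
  set e := a * b * (η / 2 * ‖x - y‖ ^ 2) with he
  have key : ∀ z : E, ‖z‖ ≤ 1 → u (a • x + b • y - δ • z) ≤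
      a * u (x - δ • z) + b * u (y - δ • z) - e := by
    intro z _
    have h1 := hu.apply_combo_le (mem_univ (x - δ • z)) (mem_univ (y - δ • z)) ha hb hab
    have e1 : a • (x - δ • z) + b • (y - δ • z) = a • x + b • y - δ • z := by
      rw [eq_sub_of_add_eq hab]; module
    rwa [e1, sub_sub_sub_cancel_right] at h1
  have hmono := integral_mollKernel_mul_mono (E := E) (f := fun z => u (a • x + b • y - δ • z))
    (g := fun z => a * u (x - δ • z) + b * u (y - δ • z) - e) (by fun_prop) (by fun_prop) key
  rwa [integral_mollKernel_mul_combo (by fun_prop) (by fun_prop)] at hmono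

end VariableScale

section Limit

variable {E : Type*} [NormedAddCommGroup E] [NormedSpace ℝ E]

/-- A function is `C²` if it is the limit of `C²` functions whose first two derivatives are
uniformly Cauchy. -/
lemma contDiff_two_of_uniformCauchySeqOn {F : ℕ → E → ℝ} {f : E → ℝ} (hF : ∀ m, ContDiff ℝ 2 (F m))
    (h0 : ∀ x, Tendsto (fun m => F m x) atTop (𝓝 (f x)))
    (h1 : UniformCauchySeqOn (fun m => fderiv ℝ (F m)) atTop univ)
    (h2 : UniformCauchySeqOn (fun m => fderiv ℝ (fderiv ℝ (F m))) atTop univ) :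
    ContDiff ℝ 2 f ∧
      ∀ x, Tendsto (fun m => fderiv ℝ (fderiv ℝ (F m)) x) atTop (𝓝 (fderiv ℝ (fderiv ℝ f) x)) := by
  have lim : ∀ {G : Type _} [NormedAddCommGroup G] [CompleteSpace G] {g : ℕ → E → G},
      UniformCauchySeqOn g atTop univ → ∃ g', TendstoUniformly g g' atTop := by
    intro G _ _ g hg
    choose g' hg' using fun x => cauchySeq_tendsto_of_complete (hg.cauchySeq (mem_univ x))
    exact ⟨g', tendstoUniformlyOn_univ.1 (hg.tendstoUniformlyOn_of_tendsto fun x _ => hg' x)⟩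
  obtain ⟨f', hf'⟩ := lim h1
  obtain ⟨f₂, hf₂⟩ := lim (G := E →L[ℝ] E →L[ℝ] ℝ) h2
  have hF1 : ∀ m, ContDiff ℝ 1 (fderiv ℝ (F m)) := fun m => (hF m).fderiv_right (by norm_num)
  have d1 : ∀ x, HasFDerivAt f (f' x) x := hasFDerivAt_of_tendstoUniformly hf'
    (fun m x => ((hF m).differentiable (by norm_num) x).hasFDerivAt) h0
  have d2 : ∀ x, HasFDerivAt f' (f₂ x) x := hasFDerivAt_of_tendstoUniformly hf₂
    (fun m x => ((hF1 m).differentiable (by norm_num) x).hasFDerivAt)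
    fun x => hf'.tendsto_at x
  have c2 : Continuous f₂ := hf₂.continuous
    (Eventually.of_forall fun m => (hF1 m).continuous_fderiv (by norm_num)).frequently
  have e1 : fderiv ℝ f = f' := funext fun x => (d1 x).fderiv
  have e2 : fderiv ℝ f' = f₂ := funext fun x => (d2 x).fderiv
  refine ⟨?_, fun x => ?_⟩
  · have : ContDiff ℝ (1 + 1) f := by
      rw [contDiff_succ_iff_fderiv, e1]
      refine ⟨fun x => (d1 x).differentiableAt, by simp, ?_⟩
      rw [contDiff_one_iff_fderiv, e2]
      exact ⟨fun x => (d2 x).differentiableAt, c2⟩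
    simpa [one_add_one_eq_two] using this
  · rw [e1, e2]
    exact hf₂.tendsto_at x

end Limit

section Cutoff

variable {E : Type*} [NormedAddCommGroup E] [InnerProductSpace ℝ E] [FiniteDimensional ℝ E]
  [MeasurableSpace E] [BorelSpace E]

variable (E) in
lemma exists_cutoff : ∃ C : ℝ, 1 ≤ C ∧ ∀ (K : Set E) (R : ℝ), 0 < R → ∃ χ : E → ℝ,
    ContDiff ℝ 2 χ ∧ (∀ x, infDist x K < R / 2 → χ x = 1) ∧
    (∀ x, 3 / 4 * R < infDist x K → χ x = 0) ∧ ∀ x, JetBound C R χ x := by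
  obtain ⟨C, hC, hjet⟩ := exists_jetBound_mollify (E := E)
  refine ⟨16 ^ 2 * C, by linarith, fun K R hR => ?_⟩
  set φ : E → ℝ := fun x => max 0 (min 1 (11 / 2 - 8 * (infDist x K / R))) with hφ
  have hφc : Continuous φ := by
    have := continuous_infDist_pt K
    fun_prop
  have hφb : ∀ x, |φ x| ≤ 1 := fun x => by
    rw [abs_of_nonneg (le_max_left _ _)]
    exact max_le zero_le_one (min_le_left _ _)
  have hdist : ∀ x z : E, ‖z‖ ≤ 1 → |infDist (x - (R / 16) • z) K - infDist x K| ≤ R / 16 := by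
    intro x z hz
    have h1 := (lipschitz_infDist_pt K).dist_le_mul (x - (R / 16) • z) x
    rw [Real.dist_eq] at h1
    refine h1.trans ?_
    rw [dist_eq_norm, sub_sub_cancel_left, norm_neg, norm_smul, Real.norm_of_nonneg (by positivity)]
    simp only [NNReal.coe_one, one_mul]
    calc R / 16 * ‖z‖ ≤ R / 16 * 1 := by gcongr
      _ = _ := mul_one _
  have hval : ∀ x c, (∀ z : E, ‖z‖ ≤ 1 → φ (x - (R / 16) • z) = c) → mollify (R / 16) φ x = c := by
    intro x c h
    rw [← integral_mollKernel_mul_const (E := E) c]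
    refine integral_congr_ae (Eventually.of_forall fun z => ?_)
    by_cases hz : ‖z‖ ≤ 1
    · simp only [h z hz]
    · simp [mollKernel_eq_zero (not_le.1 hz)]
  refine ⟨mollify (R / 16) φ, contDiff_mollify (by positivity) hφc (n := 2), fun x hx => ?_,
    fun x hx => ?_, fun x => ?_⟩
  · refine hval x 1 fun z hz => ?_
    have h1 := (abs_le.1 (hdist x z hz)).2
    have h2 : infDist (x - (R / 16) • z) K / R ≤ 9 / 16 := by
      rw [div_le_iff₀ hR]; linarith
    simp only [hφ]
    rw [min_eq_left (by linarith), max_eq_right zero_le_one]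
  · refine hval x 0 fun z hz => ?_
    have h1 := (abs_le.1 (hdist x z hz)).1
    have h2 : 11 / 16 ≤ infDist (x - (R / 16) • z) K / R := by
      rw [le_div_iff₀ hR]; linarith
    simp only [hφ]
    exact max_eq_left ((min_le_right _ _).trans (by linarith))
  · have h1 := hjet φ hφc (R / 16) (by positivity) x 1 fun y _ => hφb y
    have h2 := h1.scale_le (R' := R) (c := 16) (by positivity) hR.le (by norm_num) (by linarith)
    rwa [mul_one] at h2

variable (E) in
/-- Mollifying a function with a second order expansion at `x₀` gives a function that is
`C²`-close to the expansion. -/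
lemma exists_jetBound_mollify_sub_quadPoly (M : ℝ) : ∃ A : ℝ, 1 ≤ A ∧ ∀ (u : E → ℝ), Continuous u →
    ∀ (a : ℝ) (q : E →L[ℝ] ℝ) (H : E →L[ℝ] E) (x₀ x : E) (R k : ℝ), 0 < R → 0 < k → k ≤ 1 →
    ‖H‖ ≤ M → (∀ h, ‖h‖ ≤ 3 * R → |u (x₀ + h) - quadPoly a q H x₀ (x₀ + h)| ≤ k ^ 4 * ‖h‖ ^ 2) →
    ‖x - x₀‖ ≤ 2 * R →
    JetBound (A * k ^ 2 * R ^ 2) R (fun y => mollify (k * R) u y - quadPoly a q H x₀ y) x := by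
  obtain ⟨C, hC, hjet⟩ := exists_jetBound_mollify (E := E)
  refine ⟨9 * C + |M|, by linarith [abs_nonneg M], ?_⟩
  intro u hu a q H x₀ x R k hR hk hk1 hHM herr hx
  have hT : ContDiff ℝ 2 (quadPoly a q H x₀) := contDiff_quadPoly a q H x₀ (n := 2)
  have hkR : 0 < k * R := by positivity
  have h1 := hjet (fun y => u y - quadPoly a q H x₀ y) (hu.sub hT.continuous) (k * R) hkR x
    (k ^ 4 * (3 * R) ^ 2) fun y hy => ?_
  · have h2 := h1.scale_le (R' := R) (c := k⁻¹) hkR.le hR.le ((one_le_inv₀ hk).2 hk1)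
      (by field_simp; exact le_rfl)
    obtain ⟨c, hc, hmc⟩ := mollify_quadPoly a q H x₀ (k * R)
    have h3 : JetBound (k ^ 2 * R ^ 2 * |M|) R (fun _ : E => c) x := by
      refine JetBound.const c (hc.trans ?_)
      rw [mul_pow]
      gcongr
      exact hHM.trans (le_abs_self M)
    have h4 := h2.add h3 hR.le (contDiff_mollify hkR (hu.sub hT.continuous) (n := 2))
      contDiff_const
    refine (h4.mono (le_of_eq ?_)).congr (Eventually.of_forall fun y => ?_)
    · field_simp; ring
    · simp only
      rw [mollify_sub _ hu hT.continuous, hmc]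
      ring
  · have h5 : ‖y - x₀‖ ≤ 3 * R := by
      have : ‖y - x‖ ≤ k * R := by simpa [dist_eq_norm] using hy
      calc ‖y - x₀‖ ≤ ‖y - x‖ + ‖x - x₀‖ := norm_sub_le_norm_sub_add_norm_sub ..
        _ ≤ k * R + 2 * R := by gcongr
        _ ≤ 1 * R + 2 * R := by gcongr
        _ = 3 * R := by ring
    have h6 := herr (y - x₀) h5
    rw [add_sub_cancel] at h6
    exact h6.trans (by gcongr)

end Cutoff

section Telescope

variable {E : Type*} [NormedAddCommGroup E] [InnerProductSpace ℝ E]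

lemma JetBound.of_mul_sq {B R : ℝ} {f : E → ℝ} {x : E} (h : JetBound (B * R ^ 2) R f x)
    (hR : 0 < R) (hR1 : R ≤ 1) : JetBound B 1 f x := by
  have h1 := h.scale_le (R' := 1) (c := R⁻¹) hR.le zero_le_one ((one_le_inv₀ hR).2 hR1)
    (by field_simp; exact le_rfl)
  refine h1.mono (le_of_eq ?_)
  field_simp

lemma HessGE.of_tendsto {F : ℕ → E → ℝ} {f : E → ℝ} {x : E} {c : ℝ}
    (hF : Tendsto (fun m => fderiv ℝ (fderiv ℝ (F m)) x) atTop (𝓝 (fderiv ℝ (fderiv ℝ f) x)))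
    (h : ∀ m, HessGE (F m) x c) : HessGE f x c := by
  intro v
  have h1 : Tendsto (fun m => fderiv ℝ (fderiv ℝ (F m)) x v v) atTop
      (𝓝 (fderiv ℝ (fderiv ℝ f) x v v)) := by
    have hc : Continuous fun B : E →L[ℝ] E →L[ℝ] ℝ => B v v := by fun_prop
    exact (hc.tendsto _).comp hF
  exact ge_of_tendsto' h1 fun m => h m v

lemma uniformCauchySeqOn_of_norm_sub_le {X G : Type*} [SeminormedAddCommGroup G] {F : ℕ → X → G}
    {b : ℕ → ℝ} (hb : ∀ ε > 0, ∃ J, b J < ε)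
    (h : ∀ J m n, J ≤ m → J ≤ n → ∀ x, ‖F m x - F n x‖ ≤ b J) :
    UniformCauchySeqOn F atTop univ := by
  rw [Metric.uniformCauchySeqOn_iff]
  intro ε hε
  obtain ⟨J, hJ⟩ := hb ε hε
  refine ⟨J, fun m hm n hn x _ => ?_⟩
  rw [dist_eq_norm]
  exact (h J m n hm hn x).trans_lt hJ

/-- The successive corrections of `w 0` towards finer and finer approximations near `K`. -/
noncomputable def telescope (χ w : ℕ → E → ℝ) : ℕ → E → ℝ
  | 0 => w 0
  | m + 1 => fun x => telescope χ w m x + χ m x * (w (m + 1) x - w m x)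

lemma contDiff_telescope {χ w : ℕ → E → ℝ} (hχ : ∀ j, ContDiff ℝ 2 (χ j))
    (hw : ∀ j, ContDiff ℝ 2 (w j)) (m : ℕ) : ContDiff ℝ 2 (telescope χ w m) := by
  induction m with
  | zero => exact hw 0
  | succ m ih => exact ih.add ((hχ m).mul ((hw (m + 1)).sub (hw m)))

/-- Functions with better and better second order contact along `K` can be glued to a `C²` function
with the same second order contact. -/
lemma exists_glue_jets {K : Set E} (hK : IsCompact K) (hKne : K.Nonempty) {η : ℝ} {u : E → ℝ}
    {T : E → E → ℝ} (hT : ∀ x₀, ContDiff ℝ 2 (T x₀)) (hTu : ∀ x₀, T x₀ x₀ = u x₀)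
    {R : ℕ → ℝ} (hR : ∀ j, 0 < R j) (hR1 : ∀ j, R j ≤ 1) (hRsucc : ∀ j, 2 * R (j + 1) = R j)
    {w : ℕ → E → ℝ} (hw : ∀ j, ContDiff ℝ 2 (w j)) (hwη : ∀ j x, HessGE (w j) x η)
    {e : ℕ → ℝ} (he : Antitone e) (he0 : Tendsto e atTop (𝓝 0))
    (hjet : ∀ j, ∀ x₀ ∈ K, ∀ x, ‖x - x₀‖ ≤ 2 * R j →
      JetBound (e j * R j ^ 2) (R j) (fun y => w j y - T x₀ y) x)
    {χ : ℕ → E → ℝ} (hχ : ∀ j, ContDiff ℝ 2 (χ j))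
    (hχ1 : ∀ j x, infDist x K < R j / 2 → χ j x = 1)
    (hχ0 : ∀ j x, 3 / 4 * R j < infDist x K → χ j x = 0)
    {C : ℝ} (hC : 1 ≤ C) (hχC : ∀ j x, JetBound C (R j) (χ j) x) :
    ∃ F : E → ℝ, ContDiff ℝ 2 F ∧ (∀ x ∈ K, F x = u x) ∧ (∀ x, HessGE F x (η - 8 * C * e 0)) ∧
      (∀ x, 3 / 4 * R 0 < infDist x K → F x = w 0 x) ∧ ∀ x, |F x - w 0 x| ≤ 18 * C * e 0 := by
  set F := telescope χ w with hF
  set g : ℕ → E → ℝ := fun j x => χ j x * (w (j + 1) x - w j x) with hg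
  have hgc : ∀ j, ContDiff ℝ 2 (g j) := fun j => (hχ j).mul ((hw (j + 1)).sub (hw j))
  have hFc : ∀ m, ContDiff ℝ 2 (F m) := contDiff_telescope hχ hw
  have hFsucc : ∀ m, F (m + 1) = fun x => F m x + g m x := fun m => rfl
  have he_nonneg : ∀ j, 0 ≤ e j := he.le_of_tendsto he0
  have hRanti : Antitone R := antitone_nat_of_succ_le fun j => by
    have := hRsucc j; have := hR (j + 1); linarith
  have hcont := continuous_infDist_pt K
  have hnear : ∀ {x : E} {r : ℝ}, infDist x K < r → ∀ᶠ y in 𝓝 x, infDist y K < r :=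
    fun h => hcont.continuousAt.eventually_lt_const h
  have hnear' : ∀ {x : E} {r : ℝ}, r < infDist x K → ∀ᶠ y in 𝓝 x, r < infDist y K :=
    fun h => hcont.continuousAt.eventually_const_lt h
  have hFw : ∀ m x, infDist x K < R m → F m x = w m x := by
    intro m
    induction m with
    | zero => exact fun x _ => rfl
    | succ m ih =>
      intro x hx
      have h1 := hRsucc m
      have h2 := hR (m + 1)
      rw [hFsucc]
      simp only [hg]
      rw [ih x (by linarith), hχ1 m x (by linarith)]
      ring
  have hFw' : ∀ m x, infDist x K < R m → w m =ᶠ[𝓝 x] F m := fun m x hx => by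
    filter_upwards [hnear hx] with y hy using (hFw m y hy).symm
  have hFfar : ∀ m x, R m ≤ infDist x K → F (m + 1) =ᶠ[𝓝 x] F m := fun m x hx => by
    have : 3 / 4 * R m < infDist x K := by have := hR m; linarith
    filter_upwards [hnear' this] with y hy
    rw [hFsucc]
    simp [hg, hχ0 m y hy]
  have hgjet : ∀ m x, infDist x K < R m → JetBound (8 * C * e m * R m ^ 2) (R m) (g m) x := by
    intro m x hx
    obtain ⟨x₀, hx₀, hd⟩ := hK.exists_infDist_eq_dist hKne x
    rw [hd, dist_eq_norm] at hx
    have h1 := hjet (m + 1) x₀ hx₀ x (by rw [hRsucc]; exact hx.le)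
    have h2 := h1.scale_le (R' := R m) (c := 2) (hR _).le (hR _).le (by norm_num) (hRsucc m).ge
    have h3 := h2.sub (hjet m x₀ hx₀ x (by have := hR m; linarith)) (hR m).le
      ((hw _).sub (hT _)) ((hw _).sub (hT _))
    have h4 := (hχC m x).mul h3 (hR m).le (hχ m)
      (((hw _).sub (hT _)).sub ((hw _).sub (hT _)))
    refine (h4.mono ?_).congr (Eventually.of_forall fun y => ?_)
    · have h5 : e (m + 1) ≤ e m := he m.le_succ
      have h6 : 2 ^ 2 * (e (m + 1) * R (m + 1) ^ 2) = e (m + 1) * R m ^ 2 := by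
        rw [← hRsucc m]; ring
      rw [h6]
      have h7 : e (m + 1) * R m ^ 2 ≤ e m * R m ^ 2 := by gcongr
      have h8 : 4 * C * (e (m + 1) * R m ^ 2 + e m * R m ^ 2) ≤
          4 * C * (e m * R m ^ 2 + e m * R m ^ 2) := by gcongr
      linarith
    · simp only [hg]; ring
  have hcontact : ∀ J m, J ≤ m → ∀ x, ∀ x₀ ∈ K, infDist x K = dist x x₀ → infDist x K < R J →
      JetBound (9 * C * e J) 1 (fun y => F m y - T x₀ y) x := by
    intro J m hJm x x₀ hx₀ hd hx
    induction m, hJm using Nat.le_induction with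
    | base =>
      have h1 := (hjet J x₀ hx₀ x (by
        rw [← dist_eq_norm, ← hd]; have := hR J; linarith)).of_mul_sq (hR J) (hR1 J)
      refine (h1.mono ?_).congr ?_
      · nlinarith [he_nonneg J]
      · filter_upwards [hFw' J x hx] with y hy
        rw [hy]
    | succ m hJm ih =>
      rcases lt_or_ge (infDist x K) (R m) with hxm | hxm
      · have h1 := (hjet m x₀ hx₀ x (by
          rw [← dist_eq_norm, ← hd]; have := hR m; linarith)).of_mul_sq (hR m) (hR1 m)
        have h2 := (hgjet m x hxm).of_mul_sq (hR m) (hR1 m)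
        refine ((h1.add h2 zero_le_one ((hw _).sub (hT _)) (hgc _)).mono ?_).congr ?_
        · have := he hJm
          nlinarith [he_nonneg m]
        · filter_upwards [hFw' m x hxm] with y hy
          rw [hFsucc, hy]; ring
      · refine ih.congr ?_
        filter_upwards [hFfar m x hxm] with y hy
        rw [hy]
  have hFconst : ∀ J m, J ≤ m → ∀ x, R J ≤ infDist x K → F m =ᶠ[𝓝 x] F J := by
    intro J m hJm x hx
    induction m, hJm using Nat.le_induction with
    | base => exact EventuallyEq.rfl
    | succ m hJm ih => exact (hFfar m x ((hRanti hJm).trans hx)).trans ih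
  have hcauchy : ∀ J m n, J ≤ m → J ≤ n → ∀ x,
      JetBound (18 * C * e J) 1 (fun y => F m y - F n y) x := by
    intro J m n hm hn x
    rcases lt_or_ge (infDist x K) (R J) with hx | hx
    · obtain ⟨x₀, hx₀, hd⟩ := hK.exists_infDist_eq_dist hKne x
      have h1 := (hcontact J m hm x x₀ hx₀ hd hx).sub (hcontact J n hn x x₀ hx₀ hd hx) zero_le_one
        ((hFc _).sub (hT _)) ((hFc _).sub (hT _))
      exact (h1.mono (by linarith)).congr (Eventually.of_forall fun y => by ring)
    · have h1 : JetBound (18 * C * e J) 1 (fun _ : E => (0 : ℝ)) x := JetBound.const 0 (by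
        have := he_nonneg J
        simp only [abs_zero]; positivity)
      refine h1.congr ?_
      filter_upwards [hFconst J m hm x hx, hFconst J n hn x hx] with y h2 h3
      rw [h2, h3, sub_self]
  have hsmall : ∀ ε > 0, ∃ J, 18 * C * e J < ε := by
    intro ε hε
    have h1 : Tendsto (fun J => 18 * C * e J) atTop (𝓝 0) := by simpa using he0.const_mul (18 * C)
    exact (h1.eventually_lt_const hε).exists
  have hdiff : ∀ m, Differentiable ℝ (F m) := fun m => (hFc m).differentiable (by norm_num)
  have hdiff' : ∀ m, Differentiable ℝ (fderiv ℝ (F m)) := fun m =>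
    ((hFc m).fderiv_right (m := 1) (by norm_num)).differentiable (by norm_num)
  have hsub1 : ∀ m n, fderiv ℝ (fun y => F m y - F n y) =
      fun y => fderiv ℝ (F m) y - fderiv ℝ (F n) y := fun m n =>
    funext fun y => fderiv_fun_sub (hdiff m y) (hdiff n y)
  have hc1 : UniformCauchySeqOn (fun m => fderiv ℝ (F m)) atTop univ := by
    refine uniformCauchySeqOn_of_norm_sub_le hsmall fun J m n hm hn x => ?_
    have h1 := (hcauchy J m n hm hn x).norm_fderiv_le
    rwa [hsub1, mul_one] at h1
  have hc2 : UniformCauchySeqOn (fun m => fderiv ℝ (fderiv ℝ (F m))) atTop univ := by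
    refine uniformCauchySeqOn_of_norm_sub_le (G := E →L[ℝ] E →L[ℝ] ℝ) hsmall
      fun J m n hm hn x => ?_
    have h1 := (hcauchy J m n hm hn x).norm_fderiv_fderiv_le
    rwa [hsub1, fderiv_fun_sub (hdiff' m x) (hdiff' n x), one_pow, mul_one] at h1
  have hlim : ∀ x, ∃ y, Tendsto (fun m => F m x) atTop (𝓝 y) := fun x => by
    refine cauchySeq_tendsto_of_complete (Metric.cauchySeq_iff.2 fun ε hε => ?_)
    obtain ⟨J, hJ⟩ := hsmall ε hε
    exact ⟨J, fun m hm n hn => (hcauchy J m n hm hn x).abs_le.trans_lt hJ⟩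
  choose f hf using hlim
  obtain ⟨hfc, hf2⟩ := contDiff_two_of_uniformCauchySeqOn hFc hf hc1 hc2
  refine ⟨f, hfc, fun x hx => ?_, fun x => ?_, fun x hx => ?_, fun x => ?_⟩
  · refine eq_of_abs_sub_nonpos ?_
    have hx0 : infDist x K = 0 := infDist_zero_of_mem hx
    have h1 : Tendsto (fun J => 9 * C * e J) atTop (𝓝 0) := by simpa using he0.const_mul (9 * C)
    refine ge_of_tendsto' h1 fun J => ?_
    refine le_of_tendsto ((hf x).sub_const (u x)).abs ?_
    filter_upwards [eventually_ge_atTop J] with m hm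
    have := (hcontact J m hm x x hx (by simp [hx0]) (by simp [hx0, hR])).abs_le
    rwa [hTu] at this
  · refine HessGE.of_tendsto (hf2 x) fun m => ?_
    have hpos := he_nonneg 0
    induction m with
    | zero => exact (hwη 0 x).mono (by nlinarith)
    | succ m ih =>
      rcases lt_or_ge (infDist x K) (R m) with hxm | hxm
      · have h1 := ((hwη m x).congr (hFw' m x hxm)).add (hFc m) (hgc m)
          (e := 8 * C * e m) (by
            simpa using ((hgjet m x hxm).of_mul_sq (hR m) (hR1 m)).norm_fderiv_fderiv_le)
        refine h1.mono ?_
        have := he m.zero_le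
        nlinarith
      · exact ih.congr (hFfar m x hxm).symm
  · refine tendsto_nhds_unique (hf x) (tendsto_const_nhds.congr fun m => ?_)
    induction m with
    | zero => rfl
    | succ m ih =>
      rw [hFsucc]
      have : 3 / 4 * R m < infDist x K := by
        have := hRanti m.zero_le
        linarith
      simp [hg, hχ0 m x this, ih]
  · refine le_of_tendsto' ((hf x).sub_const (w 0 x)).abs fun m => ?_
    exact (hcauchy 0 m 0 m.zero_le le_rfl x).abs_le

end Telescope

section Local

/-- A scale-by-scale modulus along dyadic scales. -/
lemma exists_antitone_modulus {P : ℝ → ℝ → Prop}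
    (hP : ∀ k > 0, ∃ r > 0, P k r) (hmono : ∀ k k' r r', P k r → k ≤ k' → r' ≤ r → P k' r')
    {k₀ r₀ : ℝ} (hk₀ : 0 < k₀) (hr₀ : 0 < r₀) :
    ∃ (R k : ℕ → ℝ), (∀ j, 0 < R j) ∧ (∀ j, R j ≤ r₀) ∧ (∀ j, 2 * R (j + 1) = R j) ∧
      (∀ j, 0 < k j) ∧ (∀ j, k j ≤ k₀) ∧ Antitone k ∧ Tendsto k atTop (𝓝 0) ∧
      ∀ j, P (k j) (R j) := by
  set S : ℕ → Set ℝ := fun j => {k | 0 ≤ k ∧ P k ((1 / 2) ^ j)} with hS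
  set κ : ℕ → ℝ := fun j => sInf (S j) + (1 / 2) ^ j with hκ
  have hbdd : ∀ j, BddBelow (S j) := fun j => ⟨0, fun k hk => hk.1⟩
  have hpow : Tendsto (fun j : ℕ => (1 / 2 : ℝ) ^ j) atTop (𝓝 0) :=
    tendsto_pow_atTop_nhds_zero_of_lt_one (by norm_num) (by norm_num)
  have hanti : Antitone fun j : ℕ => (1 / 2 : ℝ) ^ j :=
    pow_right_anti₀ (by norm_num) (by norm_num)
  have hmem : ∀ k > 0, ∀ᶠ j in atTop, k ∈ S j := by
    intro k hk
    obtain ⟨r, hr, hPr⟩ := hP k hk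
    filter_upwards [hpow.eventually_le_const hr] with j hj
    exact ⟨hk.le, hmono _ _ _ _ hPr le_rfl hj⟩
  have hnn : ∀ j, 0 ≤ sInf (S j) := fun j => Real.sInf_nonneg fun k hk => hk.1
  have hlim : Tendsto κ atTop (𝓝 0) := by
    have h1 : Tendsto (fun j => sInf (S j)) atTop (𝓝 0) := by
      refine tendsto_order.2 ⟨fun a ha => Eventually.of_forall fun j => ha.trans_le (hnn j),
        fun a ha => ?_⟩
      filter_upwards [hmem (a / 2) (by positivity)] with j hj
      have := csInf_le (hbdd j) hj
      linarith
    have h2 := h1.add hpow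
    rwa [add_zero] at h2
  obtain ⟨j₀, hj₀⟩ := eventually_atTop.1 (((hlim.eventually_le_const hk₀).and
    (hpow.eventually_le_const hr₀)).and (hmem 1 one_pos))
  refine ⟨fun j => (1 / 2) ^ (j₀ + j), fun j => κ (j₀ + j), fun j => by positivity,
    fun j => (hj₀ _ (by lia)).1.2, fun j => by dsimp only; ring, fun j => ?_,
    fun j => (hj₀ _ (by lia)).1.1, ?_, ?_, fun j => ?_⟩
  · have := hnn (j₀ + j)
    simp only [hκ]
    positivity
  · refine antitone_nat_of_succ_le fun j => ?_
    simp only [hκ]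
    refine add_le_add (csInf_le_csInf (hbdd _) ⟨1, (hj₀ _ (by lia)).2⟩ fun k hk =>
      ⟨hk.1, hmono _ _ _ _ hk.2 le_rfl (hanti (by lia))⟩) (hanti (by lia))
  · exact hlim.comp (tendsto_add_atTop_nat j₀ |>.congr fun j => add_comm _ _)
  · have h1 : (S (j₀ + j)).Nonempty := ⟨1, (hj₀ _ (by lia)).2⟩
    obtain ⟨k, hk, hlt⟩ := exists_lt_of_csInf_lt h1
      (show sInf (S (j₀ + j)) < κ (j₀ + j) by simp only [hκ]; simp)
    exact hmono _ _ _ _ hk.2 hlt.le le_rfl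

variable {E : Type*} [NormedAddCommGroup E] [InnerProductSpace ℝ E] [FiniteDimensional ℝ E]
  [MeasurableSpace E] [BorelSpace E]

/-- A mollification of a strongly convex function `u` can be corrected near a compact set `K` on
which `u` has a uniform second order expansion, so that it agrees with `u` on `K`. -/
lemma exists_local_correction {η η' : ℝ} (hη : 0 < η) (hη' : η' < η) {u : E → ℝ}
    (hu : StrongConvexOn univ η u) {q : E → E →L[ℝ] ℝ} {H : E → E →L[ℝ] E} {K U : Set E}
    (hK : IsCompact K) (hq : UniformTaylorOn u q H K) (hU : IsOpen U) (hKU : K ⊆ U) {ε s : ℝ}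
    (hε : 0 < ε) (hs : 0 < s) :
    ∃ (δ : ℝ) (h : E → ℝ), 0 < δ ∧ δ < s ∧ ContDiff ℝ 2 h ∧ tsupport h ⊆ U ∧ (∀ x, |h x| ≤ ε) ∧
      (∀ x ∈ K, mollify δ u x + h x = u x) ∧ ∀ x, HessGE (fun y => mollify δ u y + h y) x η' := by
  have huc := hu.continuous hη.le
  have hmη : ∀ δ > 0, ∀ x, HessGE (mollify δ u) x η := fun δ hδ x =>
    hessGE_of_strongConvexOn_ball (contDiff_mollify hδ huc (n := 2)) one_pos
      ⟨convex_ball x 1, fun y _ z _ =>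
        (strongConvexOn_mollify hu hη.le δ).2 (mem_univ y) (mem_univ z)⟩
  rcases K.eq_empty_or_nonempty with rfl | hKne
  · refine ⟨s / 2, fun _ => 0, by positivity, by linarith, contDiff_const, ?_, fun x => ?_,
      fun x hx => hx.elim, fun x => ?_⟩
    · simp [tsupport]
    · simpa using hε.le
    · simpa using (hmη (s / 2) (by positivity) x).mono hη'.le
  obtain ⟨M, hM⟩ := hq.bdd
  obtain ⟨C, hC, hcut⟩ := exists_cutoff E
  obtain ⟨A, hA, hmol⟩ := exists_jetBound_mollify_sub_quadPoly E M
  obtain ⟨t, ht, htU⟩ := hK.exists_cthickening_subset_open hU hKU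
  obtain ⟨k₀, hk₀, hk₀1, hk₀ε, hk₀η⟩ : ∃ k₀ : ℝ, 0 < k₀ ∧ k₀ ≤ 1 ∧ 18 * C * (A * k₀ ^ 2) ≤ ε ∧
      8 * C * (A * k₀ ^ 2) ≤ η - η' := by
    have h1 : ∀ c : ℝ, Tendsto (fun k : ℝ => c * (A * k ^ 2)) (𝓝[>] 0) (𝓝 0) := fun c => by
      have : Continuous fun k : ℝ => c * (A * k ^ 2) := by fun_prop
      simpa using (this.tendsto 0).mono_left nhdsWithin_le_nhds
    have h2 : ∀ᶠ k : ℝ in 𝓝[>] 0, k ≤ 1 :=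
      (eventually_le_nhds one_pos).filter_mono nhdsWithin_le_nhds
    obtain ⟨k, ⟨⟨hk, hk1⟩, hk2⟩, hk3⟩ := (((eventually_mem_nhdsWithin.and h2).and
      ((h1 (18 * C)).eventually_le_const hε)).and
      ((h1 (8 * C)).eventually_le_const (sub_pos.2 hη'))).exists
    exact ⟨k, hk, hk1, hk2, hk3⟩
  set T : E → E → ℝ := fun x₀ => quadPoly (u x₀) (q x₀) (H x₀) x₀ with hTdef
  set P : ℝ → ℝ → Prop := fun k r => 0 < k ∧ ∀ x₀ ∈ K, ∀ h : E, ‖h‖ ≤ 3 * r →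
      |u (x₀ + h) - T x₀ (x₀ + h)| ≤ k ^ 4 * ‖h‖ ^ 2
    with hPdef
  have hP1 : ∀ k > 0, ∃ r > 0, P k r := by
    intro k hk
    obtain ⟨r, hr, hr'⟩ := hq.taylor (k ^ 4) (by positivity)
    refine ⟨r / 3, by positivity, hk, fun x₀ hx₀ h hh => ?_⟩
    refine le_trans (le_of_eq ?_) (hr' x₀ hx₀ h (by linarith))
    simp only [hTdef, quadPoly, add_sub_cancel_left]
    congr 1
    ring
  have hP2 : ∀ k k' r r', P k r → k ≤ k' → r' ≤ r → P k' r' := by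
    rintro k k' r r' ⟨h0, h⟩ hkk' hrr'
    refine ⟨h0.trans_le hkk', fun x₀ hx₀ v hv => ?_⟩
    exact (h x₀ hx₀ v (by linarith)).trans (by gcongr)
  obtain ⟨R, k, hR, hRr, hRs, hk, hkk, hkanti, hk0, hP⟩ := exists_antitone_modulus
    (k₀ := k₀) (r₀ := min (min 1 (s / 2)) t) hP1 hP2 hk₀ (by positivity)
  have hR1 : ∀ j, R j ≤ 1 := fun j => (hRr j).trans ((min_le_left _ _).trans (min_le_left _ _))
  have hkR : ∀ j, 0 < k j * R j := fun j => mul_pos (hk j) (hR j)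
  choose χ hχ hχ1 hχ0 hχC using fun j => hcut K (R j) (hR j)
  obtain ⟨F, hF, hFK, hFη, hFw, hFε⟩ := exists_glue_jets hK hKne (η := η) (u := u) (T := T)
    (fun x₀ => contDiff_quadPoly _ _ _ _ (n := 2)) (fun x₀ => by simp [hTdef, quadPoly]) hR hR1 hRs
    (w := fun j => mollify (k j * R j) u) (fun j => contDiff_mollify (hkR j) huc (n := 2))
    (fun j => hmη _ (hkR j)) (e := fun j => A * k j ^ 2)
    (fun i j hij => by
      have := hkanti hij
      have := (hk j).le
      dsimp only
      gcongr)
    (by simpa using (hk0.pow 2).const_mul A)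
    (fun j x₀ hx₀ x hx => hmol u huc _ _ _ x₀ x (R j) (k j) (hR j) (hk j) ((hkk j).trans hk₀1)
      (hM x₀ hx₀) (fun h hh => (hP j).2 x₀ hx₀ h hh) hx)
    hχ hχ1 hχ0 hC hχC
  have hAk : A * k 0 ^ 2 ≤ A * k₀ ^ 2 := by
    have := hkk 0
    have := (hk 0).le
    gcongr
  refine ⟨k 0 * R 0, fun x => F x - mollify (k 0 * R 0) u x, hkR 0, ?_,
    hF.sub (contDiff_mollify (hkR 0) huc (n := 2)), ?_, fun x => ?_, fun x hx => ?_, fun x => ?_⟩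
  · have h1 : R 0 ≤ s / 2 := (hRr 0).trans ((min_le_left _ _).trans (min_le_right _ _))
    have h2 : k 0 ≤ 1 := (hkk 0).trans hk₀1
    have := hR 0
    nlinarith
  · refine (closure_minimal (t := cthickening t K) ?_ isClosed_cthickening).trans htU
    intro x hx
    rcases le_or_gt (infDist x K) t with hxt | hxt
    · obtain ⟨x₀, hx₀, hd⟩ := hK.exists_infDist_eq_dist hKne x
      exact mem_cthickening_of_dist_le x x₀ t K hx₀ (hd ▸ hxt)
    · refine absurd (sub_eq_zero.2 (hFw x ?_)) hx
      have h1 : R 0 ≤ t := (hRr 0).trans (min_le_right _ _)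
      have := hR 0
      linarith
  · exact (hFε x).trans ((by gcongr : 18 * C * (A * k 0 ^ 2) ≤ 18 * C * (A * k₀ ^ 2)).trans hk₀ε)
  · rw [add_sub_cancel, hFK x hx]
  · simp only [add_sub_cancel]
    refine (hFη x).mono ?_
    have : 8 * C * (A * k 0 ^ 2) ≤ 8 * C * (A * k₀ ^ 2) := by gcongr
    linarith

end Local

section Global

variable {E : Type*} [NormedAddCommGroup E] [InnerProductSpace ℝ E]

/-- A compactly supported `C²` function is Lipschitz and has bounded second differences. -/
lemma exists_bound_of_hasCompactSupport {B : E → ℝ} (hB : ContDiff ℝ 2 B)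
    (hBc : HasCompactSupport B) : ∃ c, 0 < c ∧ (∀ x y, |B x - B y| ≤ c * ‖x - y‖) ∧
      ∀ x y : E, ∀ a b : ℝ, 0 ≤ a → 0 ≤ b → a + b = 1 →
        |a * B x + b * B y - B (a • x + b • y)| ≤ c * (a * b * ‖x - y‖ ^ 2) := by
  have hB1 : ContDiff ℝ 1 (fderiv ℝ B) := hB.fderiv_right (by norm_num)
  obtain ⟨c1, hc1⟩ := hB1.continuous.bounded_above_of_compact_support (hBc.fderiv ℝ)
  obtain ⟨c2, hc2⟩ := (hB1.continuous_fderiv (by norm_num)).bounded_above_of_compact_support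
    ((hBc.fderiv ℝ).fderiv ℝ)
  have hc1' : 0 ≤ c1 := (norm_nonneg _).trans (hc1 0)
  have hc2' : 0 ≤ c2 := (norm_nonneg _).trans (hc2 0)
  have hess : ∀ f : E → ℝ, ContDiff ℝ 2 f → (∀ x, ‖fderiv ℝ (fderiv ℝ f) x‖ ≤ c2) →
      StrongConvexOn univ (-c2) f := fun f hf h => strongConvexOn_of_hessGE hf fun x v => by
    have h1 : |fderiv ℝ (fderiv ℝ f) x v v| ≤ c2 * ‖v‖ * ‖v‖ :=
      ((fderiv ℝ (fderiv ℝ f) x).le_opNorm₂ v v).trans (by gcongr; exact h x)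
    have := (abs_le.1 h1).1
    nlinarith
  have h1 := hess B hB hc2
  have h2 := hess (fun x => -B x) hB.neg fun x => by
    have : fderiv ℝ (fun x => -B x) = fun x => -fderiv ℝ B x := funext fun x => fderiv_fun_neg
    rw [this, fderiv_fun_neg]
    exact (norm_neg (fderiv ℝ (fderiv ℝ B) x)).le.trans (hc2 x)
  refine ⟨c1 + c2 + 1, by positivity, fun x y => ?_, fun x y a b ha hb hab => ?_⟩
  · have := convex_univ.norm_image_sub_le_of_norm_fderiv_le (𝕜 := ℝ) (f := B)
      (fun x _ => hB.differentiable (by norm_num) x) (fun x _ => hc1 x) (mem_univ y) (mem_univ x)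
    refine this.trans ?_
    gcongr
    linarith
  · have h3 := h1.apply_combo_le (mem_univ x) (mem_univ y) ha hb hab
    have h4 := h2.apply_combo_le (mem_univ x) (mem_univ y) ha hb hab
    have h5 : 0 ≤ a * b * ‖x - y‖ ^ 2 := by positivity
    rw [abs_le]
    constructor <;> nlinarith

variable [FiniteDimensional ℝ E] [MeasurableSpace E] [BorelSpace E]

/-- On a ball, mollification with a scale interpolating between two small numbers preserves
strong convexity up to a small loss. -/
lemma exists_scale_bound {η η' : ℝ} (hη : 0 < η) (hη' : η' < η) {u : E → ℝ}
    (hu : StrongConvexOn univ η u) {B : E → ℝ} (hB : ContDiff ℝ 2 B) (hBc : HasCompactSupport B)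
    (hB0 : ∀ x, 0 ≤ B x) (hB1 : ∀ x, B x ≤ 1) (r : ℝ) {ε : ℝ} (hε : 0 < ε) :
    ∃ t > 0, ∀ d d' : ℝ, 0 < d → d < t → 0 < d' → d' < t →
      ContDiff ℝ 2 (fun x => mollify (d' + (d - d') * B x) u x) ∧
      ∀ x, ‖x‖ < r → HessGE (fun x => mollify (d' + (d - d') * B x) u x) x η' ∧
        |mollify (d' + (d - d') * B x) u x - u x| ≤ ε := by
  have huc := hu.continuous hη.le
  obtain ⟨c, hc, hcl, hcm⟩ := exists_bound_of_hasCompactSupport hB hBc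
  obtain ⟨L, hL0, hL⟩ : ∃ L : ℝ, 0 ≤ L ∧ ∀ x ∈ ball (0 : E) (r + 1), ∀ y ∈ ball (0 : E) (r + 1),
      |u x - u y| ≤ L * ‖x - y‖ := by
    obtain ⟨L, hL⟩ := ((hu.convexOn_univ hη.le).locallyLipschitz.locallyLipschitzOn
      (s := closedBall (0 : E) (r + 1))).exists_lipschitzOnWith_of_compact
      (isCompact_closedBall _ _)
    refine ⟨L, L.2, fun x hx y hy => ?_⟩
    have := hL.dist_le_mul x (ball_subset_closedBall hx) y (ball_subset_closedBall hy)
    rwa [Real.dist_eq, dist_eq_norm] at this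
  obtain ⟨t, ht, ht1, htc, htL, htη⟩ : ∃ t : ℝ, 0 < t ∧ t ≤ 1 ∧ t * c ≤ 1 ∧ L * t ≤ ε ∧
      ∀ D, 0 ≤ D → D ≤ t → η' ≤ η * (1 - D * c) ^ 2 - 2 * L * (D * c) := by
    have hev : ∀ f : ℝ → ℝ, Continuous f → ∀ z, f 0 < z → ∀ᶠ t in 𝓝[>] (0 : ℝ), f t ≤ z :=
      fun f hf z hz => ((hf.tendsto 0).eventually_le_const hz).filter_mono nhdsWithin_le_nhds
    obtain ⟨t, ⟨⟨⟨ht, h1⟩, h2⟩, h3⟩, h4⟩ := ((((eventually_mem_nhdsWithin.and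
      (hev (fun t => t) (by fun_prop) 1 (by norm_num))).and
      (hev (fun t => t * c) (by fun_prop) 1 (by simp))).and
      (hev (fun t => L * t) (by fun_prop) ε (by simpa))).and
      (hev (fun t => 2 * L * (t * c) - η * (1 - t * c) ^ 2) (by fun_prop) (-η')
        (by simpa using hη'))).exists
    refine ⟨t, ht, h1, h2, h3, fun D hD hDt => ?_⟩
    have e1 : D * c ≤ t * c := by gcongr
    have e2 : (1 - t * c) ^ 2 ≤ (1 - D * c) ^ 2 := by
      have : 0 ≤ 1 - t * c := by linarith
      gcongr
    have e3 : 2 * L * (D * c) ≤ 2 * L * (t * c) := by gcongr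
    have e4 : η * (1 - t * c) ^ 2 ≤ η * (1 - D * c) ^ 2 := by gcongr
    linarith
  refine ⟨t, ht, fun d d' hd hdt hd' hdt' => ?_⟩
  set P : E → ℝ := fun x => d' + (d - d') * B x with hP
  have hPpos : ∀ x, 0 < P x := fun x => by
    have h1 := hB0 x
    have h2 := hB1 x
    simp only [hP]
    rcases le_total d d' with h | h <;> nlinarith
  have hPt : ∀ x, P x ≤ t := fun x => by
    have h1 := hB0 x
    have h2 := hB1 x
    simp only [hP]
    rcases le_total d d' with h | h <;> nlinarith
  have hD : |d - d'| ≤ t := by rw [abs_le]; constructor <;> linarith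
  have hcd : ContDiff ℝ 2 fun x => mollify (P x) u x := by
    rw [← contDiffOn_univ]
    exact (contDiffOn_mollify_param huc (n := 2)).comp
      (f := fun x => (P x, x)) (by fun_prop) fun x _ => ⟨hPpos x, mem_univ x⟩
  have hT : ∀ x ∈ ball (0 : E) r, ∀ z : E, ‖z‖ ≤ 1 → x - P x • z ∈ ball (0 : E) (r + 1) := by
    intro x hx z hz
    rw [mem_ball_zero_iff] at hx ⊢
    calc ‖x - P x • z‖ ≤ ‖x‖ + ‖P x • z‖ := norm_sub_le _ _
      _ = ‖x‖ + P x * ‖z‖ := by rw [norm_smul, Real.norm_of_nonneg (hPpos x).le]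
      _ ≤ ‖x‖ + 1 * 1 := by
        have := hPt x
        gcongr
        linarith
      _ < r + 1 := by linarith
  refine ⟨hcd, fun x hx => ⟨?_, ?_⟩⟩
  · have hx' : x ∈ ball (0 : E) r := by simpa using hx
    obtain ⟨ρ, hρ, hρr⟩ := Metric.isOpen_iff.1 isOpen_ball x hx'
    have h1 := hu.mollify_param hη.le (convex_ball x ρ) (convex_ball (0 : E) (r + 1)) (δ := P)
      (l := |d - d'| * c) (m := |d - d'| * c) (L := L) ?_ hL0 ?_ ?_
      (fun y hy => hT y (hρr hy)) hL
    · exact (hessGE_of_strongConvexOn_ball hcd hρ h1).mono (htη _ (abs_nonneg _) hD)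
    · exact le_trans (by gcongr) htc
    · intro y _ z _
      have : P y - P z = (d - d') * (B y - B z) := by simp only [hP]; ring
      rw [this, abs_mul, mul_assoc]
      gcongr
      exact hcl y z
    · intro y _ z _ a b ha hb hab
      have : a * P y + b * P z - P (a • y + b • z) =
          (d - d') * (a * B y + b * B z - B (a • y + b • z)) := by
        simp only [hP]
        linear_combination d' * hab
      rw [this, abs_mul, mul_assoc]
      gcongr
      exact hcm y z a b ha hb hab
  · have hx' : x ∈ ball (0 : E) r := by simpa using hx
    have h1 : mollify (P x) u x - u x = ∫ z, mollKernel E z * (u (x - P x • z) - u x) := by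
      simp only [mul_sub]
      rw [integral_sub (integrable_mollKernel_mul (f := fun z => u (x - P x • z)) (by fun_prop))
        (integrable_mollKernel_mul continuous_const), integral_mollKernel_mul_const]
      rfl
    rw [h1]
    refine abs_integral_mollKernel_mul_le (by fun_prop) fun z hz => ?_
    refine (hL _ (hT x hx' z hz) x (ball_subset_ball (by linarith) hx')).trans ?_
    rw [sub_sub_cancel_left, norm_neg, norm_smul, Real.norm_of_nonneg (hPpos x).le]
    calc L * (P x * ‖z‖) ≤ L * (t * 1) := by
          have := hPt x
          gcongr
      _ ≤ ε := by rw [mul_one]; exact htL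

end Global

section Gluing

variable {E : Type*} [NormedAddCommGroup E] [InnerProductSpace ℝ E] [FiniteDimensional ℝ E]

/-- A smooth radial cutoff between two radii. -/
lemma exists_radial_cutoff (E : Type*) [NormedAddCommGroup E] [InnerProductSpace ℝ E]
    [FiniteDimensional ℝ E] {r R : ℝ} (hr : r < R) (hR : 0 < R) :
    ∃ B : E → ℝ, ContDiff ℝ 2 B ∧ HasCompactSupport B ∧ (∀ x, 0 ≤ B x) ∧ (∀ x, B x ≤ 1) ∧
      (∀ x, ‖x‖ < r → B x = 1) ∧ ∀ x, R < ‖x‖ → B x = 0 := by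
  let f : ContDiffBump (0 : E) := ⟨max r (R / 2), R, lt_max_of_lt_right (by positivity),
    max_lt hr (by linarith)⟩
  refine ⟨f, f.contDiff, f.hasCompactSupport, fun x => f.nonneg, fun x => f.le_one,
    fun x hx => f.one_of_mem_closedBall ?_, fun x hx => f.zero_of_le_dist ?_⟩
  · rw [mem_closedBall_zero_iff]
    exact hx.le.trans (le_max_left _ _)
  · rw [dist_zero_right]
    exact hx.le

variable [MeasurableSpace E] [BorelSpace E]

/-- A strongly convex function with uniform second order expansions on compact sets contained in
disjoint concentric shells agrees on all these sets with a `C²` function whose Hessian is bounded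
below. -/
lemma exists_contDiff_eqOn_shells {η η' : ℝ} (hη : 0 < η) (hη' : η' < η) {u : E → ℝ}
    (hu : StrongConvexOn univ η u) {q : E → E →L[ℝ] ℝ} {H : E → E →L[ℝ] E} {K : ℕ → Set E}
    (hK : ∀ m, IsCompact (K m)) (hq : ∀ m, UniformTaylorOn u q H (K m)) {a b : ℕ → ℝ}
    (ha0 : a 0 < 0) (ha : ∀ m, 0 < a (m + 1)) (hab : ∀ m, a m < b m)
    (hba : ∀ m, b m < a (m + 1)) (hb : ∀ m : ℕ, m ≤ b (m + 1))
    (hKab : ∀ m, ∀ x ∈ K m, a m < ‖x‖ ∧ ‖x‖ < b m) {ε : ℝ} (hε : 0 < ε) :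
    ∃ v : E → ℝ, ContDiff ℝ 2 v ∧ (∀ x, HessGE v x η') ∧ (∀ m, ∀ x ∈ K m, v x = u x) ∧
      ∀ x, |u x - v x| ≤ ε := by
  choose B hB hBc hB0 hB1 hBone hBzero using fun m => exists_radial_cutoff E (hba m) (ha m)
  choose t ht htB using fun m => exists_scale_bound hη hη' hu (hB m) (hBc m) (hB0 m) (hB1 m)
    (b (m + 1)) (half_pos hε)
  choose δ h hδ hδs hh hhU hhε hhK hhη using fun m => exists_local_correction hη hη' hu (hK m)
    (hq m) (U := {x | a m < ‖x‖ ∧ ‖x‖ < b m})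
    ((isOpen_lt continuous_const continuous_norm).inter
      (isOpen_lt continuous_norm continuous_const)) (hKab m)
    (by positivity : 0 < ε / 4) (lt_min (ht m) (ht (m - 1)))
  have ha_mono : StrictMono a := strictMono_nat_of_lt_succ fun m => (hab m).trans (hba m)
  have hh0 : ∀ m x, ¬(a m < ‖x‖ ∧ ‖x‖ < b m) → h m =ᶠ[𝓝 x] 0 := fun m x hx =>
    notMem_tsupport_iff_eventuallyEq.1 fun hx' => hx (hhU m hx')
  set W : ℕ → Set E := fun m => {x | a m < ‖x‖ ∧ ‖x‖ < b (m + 1)} with hWdef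
  have hshell : ∀ r s : ℝ, IsOpen {x : E | r < ‖x‖ ∧ ‖x‖ < s} := fun r s =>
    (isOpen_lt continuous_const continuous_norm).inter
      (isOpen_lt continuous_norm continuous_const)
  set M : ℕ → E → ℝ := fun m x => mollify (δ (m + 1) + (δ m - δ (m + 1)) * B m x) u x with hM
  set V : ℕ → E → ℝ := fun m x => M m x + h m x + h (m + 1) x with hV
  have hMB := fun m => htB m (δ m) (δ (m + 1)) (hδ m) ((hδs m).trans_le (min_le_left _ _))
    (hδ (m + 1)) ((hδs (m + 1)).trans_le (min_le_right _ _))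
  have hVc : ∀ m, ContDiff ℝ 2 (V m) := fun m => ((hMB m).1.add (hh m)).add (hh (m + 1))
  have hVl : ∀ m x, a m < ‖x‖ → ‖x‖ < b m → V m x = mollify (δ m) u x + h m x := by
    intro m x hx1 hx2
    have h1 := (hh0 (m + 1) x fun h => absurd h.1 (not_lt.2 (hx2.trans (hba m)).le)).self_of_nhds
    simp only [hV, hM, hBone m x hx2, h1, Pi.zero_apply, add_zero, mul_one, add_sub_cancel]
  have hVr : ∀ m x, a (m + 1) < ‖x‖ → ‖x‖ < b (m + 1) →
      V m x = mollify (δ (m + 1)) u x + h (m + 1) x := by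
    intro m x hx1 hx2
    have h1 := (hh0 m x fun h => absurd h.2 (not_lt.2 ((hba m).trans hx1).le)).self_of_nhds
    simp only [hV, hM, hBzero m x hx1, h1, Pi.zero_apply, add_zero, mul_zero]
  have hVη : ∀ m, ∀ x ∈ W m, HessGE (V m) x η' := by
    intro m x hx
    by_cases hl : a m < ‖x‖ ∧ ‖x‖ < b m
    · refine (hhη m x).congr ?_
      filter_upwards [(hshell _ _).mem_nhds hl] with y hy
      exact (hVl m y hy.1 hy.2).symm
    by_cases hr : a (m + 1) < ‖x‖ ∧ ‖x‖ < b (m + 1)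
    · refine (hhη (m + 1) x).congr ?_
      filter_upwards [(hshell _ _).mem_nhds hr] with y hy
      exact (hVr m y hy.1 hy.2).symm
    · refine ((hMB m).2 x hx.2).1.congr ?_
      filter_upwards [hh0 m x hl, hh0 (m + 1) x hr] with y hy1 hy2
      simp [hV, hM, hy1, hy2]
  have hex : ∀ x : E, ∃ m, ‖x‖ < b (m + 1) := fun x => by
    obtain ⟨m, hm⟩ := exists_nat_gt ‖x‖
    exact ⟨m, hm.trans_le (hb m)⟩
  classical
  set idx : E → ℕ := fun x => Nat.find (hex x) with hidx
  have hidxW : ∀ x, x ∈ W (idx x) := by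
    intro x
    refine ⟨?_, Nat.find_spec (hex x)⟩
    rcases hi : idx x with _ | j
    · exact ha0.trans_le (norm_nonneg x)
    · have := Nat.find_min (hex x) (m := j) (by change j < idx x; lia)
      exact (hab _).trans_le (not_lt.1 this)
  have hv : ∀ m, ∀ x ∈ W m, V (idx x) x = V m x := by
    intro m x hx
    have h1 : idx x ≤ m := Nat.find_min' (hex x) hx.2
    have h2 : ‖x‖ < b (idx x + 1) := (hidxW x).2
    have h3 : m < idx x + 1 + 1 := ha_mono.lt_iff_lt.1 (hx.1.trans (h2.trans (hba _)))
    rcases h1.eq_or_lt with h4 | h4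
    · rw [h4]
    · obtain rfl : m = idx x + 1 := by lia
      rw [hVl _ x hx.1 h2, hVr _ x hx.1 h2]
  have hev : ∀ x, V (idx x) =ᶠ[𝓝 x] fun y => V (idx y) y := fun x => by
    filter_upwards [(hshell _ _).mem_nhds (hidxW x)] with y hy
    exact (hv _ y hy).symm
  refine ⟨fun x => V (idx x) x, ?_, fun x => (hVη _ x (hidxW x)).congr (hev x),
    fun m x hx => ?_, fun x => ?_⟩
  · exact contDiff_iff_contDiffAt.2 fun x =>
      (hVc (idx x)).contDiffAt.congr_of_eventuallyEq (hev x).symm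
  · obtain ⟨h1, h2⟩ := hKab m x hx
    dsimp only
    rw [hv m x ⟨h1, h2.trans ((hba m).trans (hab (m + 1)))⟩, hVl m x h1 h2, hhK m x hx]
  · have h1 := ((hMB (idx x)).2 x (hidxW x).2).2
    have h2 := hhε (idx x) x
    have h3 := hhε (idx x + 1) x
    rw [abs_le] at h1 h2 h3 ⊢
    simp only [hV, hM]
    constructor <;> linarith

/-- A compact set inside an open shell lies in a slightly smaller shell. -/
lemma IsCompact.exists_shell {F : Type*} [NormedAddCommGroup F] {K : Set F} (hK : IsCompact K)
    {r s : ℝ} (hrs : r < s) (h : ∀ x ∈ K, r < ‖x‖ ∧ ‖x‖ < s) :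
    ∃ a b, r < a ∧ a < b ∧ b < s ∧ ∀ x ∈ K, a < ‖x‖ ∧ ‖x‖ < b := by
  rcases K.eq_empty_or_nonempty with rfl | hne
  · obtain ⟨a, ha, ha'⟩ := exists_between hrs
    obtain ⟨b, hb, hb'⟩ := exists_between ha'
    exact ⟨a, b, ha, hb, hb', by simp⟩
  obtain ⟨x, hx, hxm⟩ := hK.exists_isMinOn hne continuous_norm.continuousOn
  obtain ⟨y, hy, hym⟩ := hK.exists_isMaxOn hne continuous_norm.continuousOn
  obtain ⟨a, ha, ha'⟩ := exists_between (h x hx).1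
  obtain ⟨b, hb, hb'⟩ := exists_between (h y hy).2
  exact ⟨a, b, ha, ha'.trans_le ((hxm hy).trans hb.le), hb', fun z hz =>
    ⟨ha'.trans_le (hxm hz), (hym hz).trans_lt hb⟩⟩

/-- Lusin approximation of strongly convex functions by `C²` strongly convex functions. -/
theorem StrongConvexOn.exists_contDiff_two_approx [Nontrivial E] (μ : Measure E)
    [μ.IsAddHaarMeasure] {η η' : ℝ} (hη : 0 < η) (hη' : η' < η) {u : E → ℝ}
    (hu : StrongConvexOn univ η u) {ε : ℝ} (hε : 0 < ε) {e : ℝ≥0∞} (he : e ≠ 0) :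
    ∃ v : E → ℝ, ContDiff ℝ 2 v ∧ StrongConvexOn univ η' v ∧ μ {x | u x ≠ v x} < e ∧
      ∀ x, |u x - v x| ≤ ε := by
  obtain ⟨q, H, hq, hH, hae⟩ := hu.ae_taylor hη μ
  obtain ⟨e', hpos, he'⟩ := ENNReal.exists_pos_sum_of_countable' he ℕ
  set S : ℕ → Set E := fun m => {x | (m : ℝ) - 1 < ‖x‖ ∧ ‖x‖ < m} with hS
  have hSm : ∀ m, MeasurableSet (S m) := fun m =>
    (measurableSet_lt measurable_const measurable_norm).inter
      (measurableSet_lt measurable_norm measurable_const)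
  have hSf : ∀ m, μ (S m) ≠ ∞ := fun m => ne_top_of_le_ne_top
    (measure_ball_lt_top (x := (0 : E)) (r := m)).ne
    (measure_mono fun x hx => by simpa using hx.2)
  choose K hKS hK hKμ hKT using fun m => exists_isCompact_uniformTaylorOn (hu.continuous hη.le)
    hq hH hae (hSm m) (hSf m) (hpos m).ne'
  choose a b ha hab hb hKab using fun m => (hK m).exists_shell
    (by linarith : (m : ℝ) - 1 < m) (hKS m)
  have ha' : ∀ m : ℕ, (m : ℝ) < a (m + 1) := fun m => by simpa using ha (m + 1)
  obtain ⟨v, hv, hvη, hvK, hvε⟩ := exists_contDiff_eqOn_shells hη hη' hu hK hKT (a := a) (b := b)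
    (by simpa using (hab 0).trans (hb 0)) (fun m => m.cast_nonneg.trans_lt (ha' m)) hab
    (fun m => (hb m).trans (ha' m)) (fun m => ((ha' m).trans (hab _)).le) hKab hε
  refine ⟨v, hv, strongConvexOn_of_hessGE hv hvη, ?_, hvε⟩
  have hsub : {x | u x ≠ v x} ⊆ (⋃ m : ℕ, sphere (0 : E) m) ∪ ⋃ m, S m \ K m := by
    intro x hx
    obtain ⟨m, hm, hm'⟩ : ∃ m : ℕ, (m : ℝ) - 1 < ‖x‖ ∧ ‖x‖ ≤ m :=
      ⟨⌈‖x‖⌉₊, by linarith [Nat.ceil_lt_add_one (norm_nonneg x)], Nat.le_ceil _⟩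
    rcases hm'.eq_or_lt with h | h
    · exact Or.inl (mem_iUnion.2 ⟨m, by simpa using h⟩)
    · exact Or.inr (mem_iUnion.2 ⟨m, ⟨hm, h⟩, fun hxK => hx (hvK m x hxK).symm⟩)
  calc μ {x | u x ≠ v x} ≤ μ (⋃ m : ℕ, sphere (0 : E) m) + μ (⋃ m, S m \ K m) :=
        (measure_mono hsub).trans (measure_union_le _ _)
    _ = μ (⋃ m, S m \ K m) := by
        rw [measure_iUnion_null fun m : ℕ => Measure.addHaar_sphere μ 0 m, zero_add]
    _ ≤ ∑' m, e' m := (measure_iUnion_le _).trans (ENNReal.tsum_le_tsum fun m => (hKμ m).le)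
    _ < e := he'

end Gluing

/-- Corollary: Lusin-type approximation of strongly convex functions by `C²`
strongly convex functions, with uniform closeness. -/
theorem strongly_convex_C2_lusin_approx_uniform {n : ℕ}
    (u : EuclideanSpace ℝ (Fin n) → ℝ) (η : ℝ) (hη : 0 < η)
    (hu : StronglyConvexWith η u)
    (ε : ℝ) (hε : 0 < ε) (η' : ℝ) (hη' : 0 < η') (hη'η : η' < η) :
    ∃ v : EuclideanSpace ℝ (Fin n) → ℝ,
      ContDiff ℝ 2 v ∧ StronglyConvexWith η' v ∧
      volume {x | u x ≠ v x} < ENNReal.ofReal ε ∧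
      ∃ δ : ℝ, δ < ε ∧ ∀ x, |u x - v x| ≤ δ := by
  have hu' : StrongConvexOn univ η u := strongConvexOn_iff_convex.2 hu
  rcases n.eq_zero_or_pos with rfl | hn
  · have hc : ContDiff ℝ 2 u := by
      rw [eq_const_of_subsingleton u 0]
      exact contDiff_const
    exact ⟨u, hc, strongConvexOn_iff_convex.1 (hu'.mono hη'η.le),
      by simpa using hε, 0, hε, by simp⟩
  · have : Nonempty (Fin n) := ⟨⟨0, hn⟩⟩
    obtain ⟨v, hv, hvη, hvμ, hvε⟩ := hu'.exists_contDiff_two_approx volume hη hη'η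
      (half_pos hε) (ENNReal.ofReal_pos.2 hε).ne'
    exact ⟨v, hv, strongConvexOn_iff_convex.1 hvη, hvμ, ε / 2, half_lt_self hε, hvε⟩
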